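/- Let β > β_c and h = 0. The limits θ_+ := −lim_{n→∞} n^{−1} log ν_{β,0}^+( η_i = −1 for all i ∈ {−n,…,−1} ) and θ_− := −lim_{n→∞} n^{−1} log ν_{β,0}^+( η_i = +1 for all i ∈ {−n,…,−1} ) exist, and θ_− < θ_+. -/

import Mathlib

open MeasureTheory Filter Topology ProbabilityTheory

noncomputable section

/-- Spin value of a Boolean spin: `true ↦ +1`, `false ↦ -1`. -/
def sval (b : Bool) : ℝ := if b then 1 else -1

/-- Two-dimensional spin configurations. -/
abbrev Cfg2 := ℤ × ℤ → Bool

/-- Two-sided sequences over an alphabet `A`. -/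
abbrev ZSeq (A : Type*) := ℤ → A

/-- Pasts: index `k` corresponds to the coordinate `-(k+1)`. -/
abbrev Past (A : Type*) := ℕ → A

/-- The four nearest neighbours of a site of `ℤ²`. -/
def nbrs (x : ℤ × ℤ) : Finset (ℤ × ℤ) :=
  {(x.1 + 1, x.2), (x.1 - 1, x.2), (x.1, x.2 + 1), (x.1, x.2 - 1)}

/-- Boltzmann weight
`exp(β[Σ_{{x,y}⊆Λ, x∼y} ω_x ω_y + Σ_{x∈Λ, y∉Λ, x∼y} ω_x σ_y] − h Σ_{x∈Λ} ω_x)`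
(the sum over unordered pairs inside `Λ` is written as half the ordered sum). -/
def isingWeight (β h : ℝ) (Λ : Finset (ℤ × ℤ)) (σ ω : Cfg2) : ℝ :=
  Real.exp (β * ((∑ x ∈ Λ, ∑ y ∈ Λ.filter (fun y => y ∈ nbrs x),
        sval (ω x) * sval (ω y)) / 2
      + ∑ x ∈ Λ, ∑ y ∈ (nbrs x).filter (fun y => y ∉ Λ), sval (ω x) * sval (σ y))
    - h * ∑ x ∈ Λ, sval (ω x))

/-- Fill in the values `τ` inside `Λ` and `σ` outside. -/
def fill (Λ : Finset (ℤ × ℤ)) (σ : Cfg2) (τ : ↥Λ → Bool) : Cfg2 :=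
  fun x => if hx : x ∈ Λ then τ ⟨x, hx⟩ else σ x

/-- The finite-volume Ising measure in `Λ` with boundary condition `σ`, viewed as a measure on
the full configuration space, the spins outside `Λ` being frozen to `σ`. -/
def isingFV (β h : ℝ) (Λ : Finset (ℤ × ℤ)) (σ : Cfg2) : Measure Cfg2 :=
  (∑ τ : ↥Λ → Bool, ENNReal.ofReal (isingWeight β h Λ σ (fill Λ σ τ)))⁻¹ •
    ∑ τ : ↥Λ → Bool,
      ENNReal.ofReal (isingWeight β h Λ σ (fill Λ σ τ)) • Measure.dirac (fill Λ σ τ)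

/-- The box `[-n,n]²`. -/
def box (n : ℕ) : Finset (ℤ × ℤ) :=
  (Finset.Icc (-(n : ℤ)) (n : ℤ)) ×ˢ (Finset.Icc (-(n : ℤ)) (n : ℤ))

/-- Convergence of a sequence of measures on a product space in the sense of convergence of the
measures of all finite-dimensional cylinder events; for probability measures on `{−1,+1}^ι`
this is exactly weak convergence. -/
def CylTendsto {ι A : Type*} [MeasurableSpace A] (μs : ℕ → Measure (ι → A))
    (μ : Measure (ι → A)) : Prop :=
  ∀ (s : Finset ι) (f : ι → A),
    Tendsto (fun n => μs n {η | ∀ i ∈ s, η i = f i}) atTop (𝓝 (μ {η | ∀ i ∈ s, η i = f i}))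

/-- `μ` is the plus phase `μ_{β,h}^+`: the weak limit of the finite-volume Ising measures on
`[-n,n]²` with all-plus boundary conditions. -/
def IsPlusPhase (β h : ℝ) (μ : Measure Cfg2) : Prop :=
  IsProbabilityMeasure μ ∧ CylTendsto (fun n => isingFV β h (box n) (fun _ => true)) μ

/-- `μ` is the minus phase `μ_{β,h}^-`. -/
def IsMinusPhase (β h : ℝ) (μ : Measure Cfg2) : Prop :=
  IsProbabilityMeasure μ ∧ CylTendsto (fun n => isingFV β h (box n) (fun _ => false)) μ

/-- The critical inverse temperature `β_c = ln(1+√2)/2`. -/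
def betaCrit : ℝ := Real.log (1 + Real.sqrt 2) / 2

/-- Projection of a two-dimensional configuration onto the line `ℤ × {0}`. -/
def lineProj (η : Cfg2) : ZSeq Bool := fun i => η (i, 0)

/-- The Schonmann projection of a measure on `{−1,+1}^{ℤ²}`. -/
def schonmann (μ : Measure Cfg2) : Measure (ZSeq Bool) := μ.map lineProj

/-- Restriction of a two-sided sequence to its strict past; index `k` is coordinate `-(k+1)`. -/
def restrictPast {A : Type*} (ω : ZSeq A) : Past A := fun k => ω (-(k + 1 : ℤ))

/-- The shift on two-sided sequences. -/
def shiftSeq {A : Type*} : ZSeq A → ZSeq A := fun ω i => ω (i + 1)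

/-- The σ-algebra `ℱ_{<0}` generated by the coordinates of negative index. -/
def pastSigma (A : Type*) [MeasurableSpace A] : MeasurableSpace (ZSeq A) :=
  MeasurableSpace.comap (fun ω : ZSeq A => restrictPast ω) inferInstance

/-- The σ-algebra generated by the coordinates in `S`. -/
def sigmaOn {ι A : Type*} [MeasurableSpace A] (S : Set ι) : MeasurableSpace (ι → A) :=
  MeasurableSpace.comap (fun ω : ι → A => S.restrict ω) inferInstance

/-- A g-function on the alphabet `A`: measurable, `[0,1]`-valued, normalized. -/
def IsGFunction {A : Type*} [Fintype A] [MeasurableSpace A] (P : A → Past A → ℝ) : Prop :=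
  (∀ a, Measurable (P a)) ∧ ∀ ω, (∑ a : A, P a ω) = 1 ∧ ∀ a, P a ω ∈ Set.Icc (0 : ℝ) 1

/-- `μ` is a translation-invariant g-measure consistent with the g-function `P`: for each `a`,
`ω ↦ P a (restrictPast ω)` is a version of the conditional probability `μ(X₀ = a | ℱ_{<0})`. -/
def IsGMeasure {A : Type*} [MeasurableSpace A] (μ : Measure (ZSeq A))
    (P : A → Past A → ℝ) : Prop :=
  IsProbabilityMeasure μ ∧ μ.map shiftSeq = μ ∧
    ∀ a : A, (fun ω => P a (restrictPast ω))
      =ᵐ[μ] μ[Set.indicator {ω : ZSeq A | ω 0 = a} (fun _ => (1 : ℝ)) | pastSigma A]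

/-- The `k`-th variation of a g-function: the supremum of `|P a ω − P a σ|` over pasts agreeing
on the coordinates `−k,…,−1`. -/
def varG {A : Type*} (P : A → Past A → ℝ) (k : ℕ) : ℝ :=
  sSup {d : ℝ | ∃ (a : A) (ω σ' : Past A), (∀ j < k, ω j = σ' j) ∧ d = |P a ω - P a σ'|}

/-- Elementary conditional probability `μ(B | A)`, as a real number. -/
def condProbR {X : Type*} [MeasurableSpace X] (μ : Measure X) (B A : Set X) : ℝ :=
  ((μ[|A]) B).toReal

/-- The event that `η_i = ω` (suitably reindexed) for `−n ≤ i ≤ −1` and `η_i = b`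
for `−(n+l) ≤ i ≤ −(n+1)`. -/
def pastEvt (n l : ℕ) (b : Bool) (ω : Past Bool) : Set (ZSeq Bool) :=
  {η | (∀ i : ℤ, -(n : ℤ) ≤ i → i ≤ -1 → η i = ω (i.natAbs - 1)) ∧
       (∀ i : ℤ, -((n : ℤ) + l) ≤ i → i ≤ -((n : ℤ) + 1) → η i = b)}

/-- The event that `η_i = b` for `−(n+l) ≤ i ≤ −n`. -/
def blockEvt (n l : ℕ) (b : Bool) : Set (ZSeq Bool) :=
  {η | ∀ i : ℤ, -((n : ℤ) + l) ≤ i → i ≤ -(n : ℤ) → η i = b}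

/-- The event that `η_i = b` for `−n ≤ i ≤ −1`. -/
def allBlock (n : ℕ) (b : Bool) : Set (ZSeq Bool) :=
  {η | ∀ i : ℤ, -(n : ℤ) ≤ i → i ≤ -1 → η i = b}

/-- `P` is the g-function `P^{+,b}` obtained from `ν` by conditioning on the symbol `b`
in the far past: `P(a|ω) = lim_n lim_l ν(η₀ = a | η = b on [−(n+l),−(n+1)], η = ω on [−n,−1])`,
both iterated limits being required to exist. -/
def IsCondG (ν : Measure (ZSeq Bool)) (b : Bool) (P : Bool → Past Bool → ℝ) : Prop :=
  ∀ (a : Bool) (ω : Past Bool), ∃ L : ℕ → ℝ,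
    (∀ n, Tendsto (fun l => condProbR ν {η | η 0 = a} (pastEvt n l b ω)) atTop (𝓝 (L n))) ∧
    Tendsto L atTop (𝓝 (P a ω))

/-- `ν'` is the iterated weak limit `lim_n lim_l ν( · | η = b on [−(n+l),−n])`. -/
def IsCondLimitMeasure (ν : Measure (ZSeq Bool)) (b : Bool) (ν' : Measure (ZSeq Bool)) : Prop :=
  ∃ νseq : ℕ → Measure (ZSeq Bool),
    (∀ n, CylTendsto (fun l => ν[|blockEvt n l b]) (νseq n)) ∧ CylTendsto νseq ν'

/-- Stochastic domination: `ν ≤ μ` iff `ν B ≤ μ B` for every increasing measurable event `B`. -/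
def StochDom {A : Type*} [MeasurableSpace A] [Preorder A]
    (ν μ : Measure (ZSeq A)) : Prop :=
  ∀ B : Set (ZSeq A), MeasurableSet B → (∀ ⦃x y : ZSeq A⦄, x ≤ y → x ∈ B → y ∈ B) → ν B ≤ μ B

/-- `π` is the i.i.d. product measure with `π(η_i = +1) = ρ` for each coordinate. -/
def IsBernoulliProd (ρ : ℝ) (π : Measure (ZSeq Bool)) : Prop :=
  IsProbabilityMeasure π ∧ ∀ (s : Finset ℤ) (f : ℤ → Bool),
    π {η | ∀ i ∈ s, η i = f i} = ∏ i ∈ s, ENNReal.ofReal (if f i then ρ else 1 - ρ)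

/-- Splicing of pasts: coordinates `−k,…,−1` (indices `< k`) from `ω`, the rest from `σ`. -/
def splice {A : Type*} (σ ω : Past A) (k : ℕ) : Past A := fun j => if j < k then ω j else σ j

/-- `ν'` is an extreme point of the convex set of g-measures consistent with `P`. -/
def ExtremeGMeasure (ν' : Measure (ZSeq Bool)) (P : Bool → Past Bool → ℝ) : Prop :=
  IsGMeasure ν' P ∧
  ∀ ν₁ ν₂ : Measure (ZSeq Bool), IsGMeasure ν₁ P → IsGMeasure ν₂ P →
    ∀ t : ℝ, t ∈ Set.Ioo (0 : ℝ) 1 →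
      ν' = ENNReal.ofReal t • ν₁ + ENNReal.ofReal (1 - t) • ν₂ → ν₁ = ν' ∧ ν₂ = ν'

/-- The event that the spins on the line are `−1` on `{−m,…,−n} × {0}`. -/
def lineMinusEvt (n m : ℕ) : Set Cfg2 :=
  {η | ∀ i : ℤ, -(m : ℤ) ≤ i → i ≤ -(n : ℤ) → η (i, 0) = false}

/-- Nearest-neighbour adjacency in `ℤ²` (`‖x−y‖₁ = 1`). -/
def adj2 (x y : ℤ × ℤ) : Prop := (x.1 - y.1).natAbs + (x.2 - y.2).natAbs = 1

/-- The event `A_n`: there is an infinite nearest-neighbour path of `+1` spins starting at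
`(n,0)` entirely contained in the half-plane `{x ≤ n}`. -/
def plusPathEvt (n : ℕ) : Set Cfg2 :=
  {η | ∃ γ : ℕ → ℤ × ℤ, γ 0 = ((n : ℤ), 0) ∧ (∀ j, adj2 (γ j) (γ (j + 1))) ∧
    Function.Injective γ ∧ (∀ j, (γ j).1 ≤ (n : ℤ)) ∧ ∀ j, η (γ j) = true}

/-- The block map for the decimation `ν_{l,k}`: the `j`-th letter consists of the spins on
`[j(k+l), j(k+l)+l−1]`. -/
def blockMap (l k : ℕ) (η : ZSeq Bool) : ZSeq (Fin l → Bool) :=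
  fun j r => η (j * ((k : ℤ) + l) + r)

end

namespace PeierlsIsing

/-- The number of nearest-neighbour bonds separating `A` from its complement. -/
def perim (A : Finset (ℤ × ℤ)) : ℕ := ∑ x ∈ A, ∑ y ∈ nbrs x, if y ∈ A then 0 else 1

/-- The configuration whose minus spins are exactly the sites of `A`. -/
def minusOn (A : Finset (ℤ × ℤ)) : Cfg2 := fun x => decide (x ∉ A)

lemma mem_nbrs_comm {x y : ℤ × ℤ} : y ∈ nbrs x ↔ x ∈ nbrs y := by
  obtain ⟨a, b⟩ := x
  obtain ⟨c, d⟩ := y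
  simp only [nbrs, Finset.mem_insert, Finset.mem_singleton, Prod.mk.injEq]
  omega

lemma perim_eq_sum {A P : Finset (ℤ × ℤ)} (h : A ⊆ P) :
    perim A = ∑ x ∈ P, ∑ y ∈ nbrs x, if x ∈ A ∧ y ∉ A then 1 else 0 := by
  rw [perim, ← Finset.sum_subset h]
  · refine Finset.sum_congr rfl fun x hx => Finset.sum_congr rfl fun y _ => ?_
    by_cases hy : y ∈ A <;> simp [hx, hy]
  · intro x _ hx
    simp [hx]

lemma perim_inter_add_perim_union_le (s t : Finset (ℤ × ℤ)) :
    perim (s ∩ t) + perim (s ∪ t) ≤ perim s + perim t := by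
  have h1 : s ∩ t ⊆ s ∪ t := Finset.inter_subset_left.trans Finset.subset_union_left
  rw [perim_eq_sum h1, perim_eq_sum (subset_refl (s ∪ t)),
    perim_eq_sum (Finset.subset_union_left (s₁ := s) (s₂ := t)),
    perim_eq_sum (Finset.subset_union_right (s₁ := s) (s₂ := t)), ← Finset.sum_add_distrib,
    ← Finset.sum_add_distrib]
  refine Finset.sum_le_sum fun x _ => ?_
  rw [← Finset.sum_add_distrib, ← Finset.sum_add_distrib]
  refine Finset.sum_le_sum fun y _ => ?_
  by_cases a : x ∈ s <;> by_cases b : x ∈ t <;> by_cases c : y ∈ s <;> by_cases d : y ∈ t <;>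
    simp [a, b, c, d]

lemma perim_map_addRight (A : Finset (ℤ × ℤ)) (t : ℤ × ℤ) :
    perim (A.map (addRightEmbedding t)) = perim A := by
  rw [perim, perim, Finset.sum_map]
  refine Finset.sum_congr rfl fun x _ => ?_
  have : nbrs (addRightEmbedding t x) = (nbrs x).map (addRightEmbedding t) := by
    ext ⟨a, b⟩
    simp only [nbrs, Finset.map_insert, Finset.map_singleton, addRightEmbedding_apply,
      Finset.mem_insert, Finset.mem_singleton, Prod.ext_iff, Prod.fst_add, Prod.snd_add]
    omega
  rw [this, Finset.sum_map]
  simp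

lemma perim_symmDiff_singleton_le (A : Finset (ℤ × ℤ)) (z : ℤ × ℤ) :
    perim (symmDiff A {z}) ≤ perim A + 8 := by
  have h1 : symmDiff A {z} ⊆ A ∪ {z} := by
    intro x; simp only [Finset.mem_symmDiff, Finset.mem_union]; tauto
  rw [perim_eq_sum h1, perim_eq_sum (Finset.subset_union_left (s₁ := A) (s₂ := {z}))]
  have key : ∀ x y : ℤ × ℤ, (if x ∈ symmDiff A {z} ∧ y ∉ symmDiff A {z} then 1 else 0) ≤
      (if x ∈ A ∧ y ∉ A then 1 else 0) + ((if x = z then 1 else 0) + if y = z then 1 else 0) := by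
    intro x y
    simp only [Finset.mem_symmDiff, Finset.mem_singleton]
    by_cases a : x ∈ A <;> by_cases b : y ∈ A <;> by_cases c : x = z <;> by_cases d : y = z <;>
      simp [a, b, c, d] <;> split_ifs <;> simp
  refine (Finset.sum_le_sum fun x _ => Finset.sum_le_sum fun y _ => key x y).trans ?_
  simp only [Finset.sum_add_distrib]
  have hc : ∀ x, (nbrs x).card ≤ 4 := fun x => Finset.card_le_four
  have e1 : ∑ x ∈ A ∪ {z}, ∑ y ∈ nbrs x, (if x = z then 1 else 0) ≤ 4 := by
    simp only [Finset.sum_const, smul_eq_mul, mul_ite, mul_one, mul_zero]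
    rw [Finset.sum_ite_eq']
    split_ifs
    · exact hc z
    · simp
  have e2 : ∑ x ∈ A ∪ {z}, ∑ y ∈ nbrs x, (if y = z then 1 else 0) ≤ 4 := by
    have : ∀ x ∈ A ∪ {z}, ∑ y ∈ nbrs x, (if y = z then 1 else 0) =
        if x ∈ nbrs z then 1 else 0 := by
      intro x _
      rw [Finset.sum_ite_eq']
      simp only [mem_nbrs_comm]
    rw [Finset.sum_congr rfl this, ← Finset.card_filter]
    exact (Finset.card_le_card fun x hx => (Finset.mem_filter.1 hx).2).trans (hc z)
  omega

lemma sval_minusOn_mul (A : Finset (ℤ × ℤ)) (x y : ℤ × ℤ) :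
    sval (minusOn A x) * sval (minusOn A y) = 1 - 2 * ((if x ∈ A ∧ y ∉ A then 1 else 0) +
      (if y ∈ A ∧ x ∉ A then 1 else 0)) := by
  by_cases hx : x ∈ A <;> by_cases hy : y ∈ A <;> simp [sval, minusOn, hx, hy] <;> norm_num

/-- The contour representation of the Boltzmann weight under plus boundary conditions. -/
lemma isingWeight_minusOn (β : ℝ) {Λ A : Finset (ℤ × ℤ)} (h : A ⊆ Λ) :
    isingWeight β 0 Λ (fun _ => true) (minusOn A) =
      isingWeight β 0 Λ (fun _ => true) (minusOn ∅) * Real.exp (-2 * β) ^ perim A := by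
  rw [isingWeight, isingWeight, ← Real.exp_nat_mul, ← Real.exp_add]
  congr 1
  have hp : (perim A : ℝ) = ∑ x ∈ Λ, ∑ y ∈ Λ.filter (fun y => y ∈ nbrs x),
        (if x ∈ A ∧ y ∉ A then (1 : ℝ) else 0) +
      ∑ x ∈ Λ, ∑ y ∈ (nbrs x).filter (fun y => y ∉ Λ), (if x ∈ A ∧ y ∉ A then (1 : ℝ) else 0) := by
    rw [perim_eq_sum h, ← Finset.sum_add_distrib]
    push_cast
    refine Finset.sum_congr rfl fun x _ => ?_
    rw [← Finset.sum_filter_add_sum_filter_not (nbrs x) (fun y => y ∈ Λ)]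
    congr 2
    ext y
    simp only [Finset.mem_filter]
    tauto
  have hs : ∑ x ∈ Λ, ∑ y ∈ Λ.filter (fun y => y ∈ nbrs x),
        (if y ∈ A ∧ x ∉ A then (1 : ℝ) else 0) =
      ∑ x ∈ Λ, ∑ y ∈ Λ.filter (fun y => y ∈ nbrs x), (if x ∈ A ∧ y ∉ A then (1 : ℝ) else 0) := by
    refine Finset.sum_comm' fun x y => ?_
    simp only [Finset.mem_filter]
    rw [mem_nbrs_comm]
    tauto
  have hi : ∀ B : Finset (ℤ × ℤ), ∑ x ∈ Λ, ∑ y ∈ Λ.filter (fun y => y ∈ nbrs x),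
      sval (minusOn B x) * sval (minusOn B y) = ∑ x ∈ Λ, ∑ y ∈ Λ.filter (fun y => y ∈ nbrs x), 1 -
      2 * (∑ x ∈ Λ, ∑ y ∈ Λ.filter (fun y => y ∈ nbrs x), (if x ∈ B ∧ y ∉ B then (1 : ℝ) else 0) +
       ∑ x ∈ Λ, ∑ y ∈ Λ.filter (fun y => y ∈ nbrs x),
        (if y ∈ B ∧ x ∉ B then (1 : ℝ) else 0)) := by
    intro B
    simp only [sval_minusOn_mul, Finset.sum_sub_distrib, ← Finset.mul_sum, Finset.sum_add_distrib]
  have hb : ∀ B ⊆ Λ, ∑ x ∈ Λ, ∑ y ∈ (nbrs x).filter (fun y => y ∉ Λ),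
      sval (minusOn B x) * sval true = ∑ x ∈ Λ, ∑ y ∈ (nbrs x).filter (fun y => y ∉ Λ), 1 -
      2 * ∑ x ∈ Λ, ∑ y ∈ (nbrs x).filter (fun y => y ∉ Λ),
        (if x ∈ B ∧ y ∉ B then (1 : ℝ) else 0) := by
    intro B hB
    simp only [Finset.mul_sum, ← Finset.sum_sub_distrib]
    refine Finset.sum_congr rfl fun x _ => Finset.sum_congr rfl fun y hy => ?_
    have hy' : y ∉ B := fun hh => (Finset.mem_filter.1 hy).2 (hB hh)
    by_cases hx : x ∈ B <;> simp [sval, minusOn, hx, hy']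
    norm_num
  rw [hi, hi, hb A h, hb ∅ (Finset.empty_subset _), hs, hp]
  simp
  ring

/-- The sum of `x ^ perim A` over the sets `A` of minus spins with `B ⊆ A ⊆ Λ`. -/
noncomputable def contourSum (x : ℝ) (B Λ : Finset (ℤ × ℤ)) : ℝ :=
  ∑ A ∈ Finset.Icc B Λ, x ^ perim A

lemma contourSum_nonneg {x : ℝ} (hx : 0 ≤ x) (B Λ : Finset (ℤ × ℤ)) : 0 ≤ contourSum x B Λ :=
  Finset.sum_nonneg fun _ _ => pow_nonneg hx _

lemma contourSum_empty_pos {x : ℝ} (hx : 0 < x) (Λ : Finset (ℤ × ℤ)) : 0 < contourSum x ∅ Λ :=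
  Finset.sum_pos (fun _ _ => pow_pos hx _) ⟨∅, by simp⟩

lemma contourSum_mono {x : ℝ} (hx : 0 ≤ x) {B Λ Λ' : Finset (ℤ × ℤ)} (h : Λ ⊆ Λ') :
    contourSum x B Λ ≤ contourSum x B Λ' :=
  Finset.sum_le_sum_of_subset_of_nonneg (Finset.Icc_subset_Icc le_rfl h)
    fun _ _ _ => pow_nonneg hx _

lemma contourSum_anti {x : ℝ} (hx : 0 ≤ x) {B B' Λ : Finset (ℤ × ℤ)} (h : B ⊆ B') :
    contourSum x B' Λ ≤ contourSum x B Λ :=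
  Finset.sum_le_sum_of_subset_of_nonneg (Finset.Icc_subset_Icc h le_rfl)
    fun _ _ _ => pow_nonneg hx _

/-- The FKG inequality for contour sums. -/
lemma contourSum_mul_le {x : ℝ} (hx : 0 ≤ x) (hx1 : x ≤ 1) (B₁ Λ₁ B₂ Λ₂ : Finset (ℤ × ℤ)) :
    contourSum x B₁ Λ₁ * contourSum x B₂ Λ₂ ≤
      contourSum x (B₁ ∩ B₂) (Λ₁ ∩ Λ₂) * contourSum x (B₁ ∪ B₂) (Λ₁ ∪ Λ₂) := by
  have h0 : (0 : Finset (ℤ × ℤ) → ℝ) ≤ fun A => x ^ perim A := fun A => pow_nonneg hx _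
  set u := Λ₁ ∪ Λ₂
  refine (Finset.four_functions_theorem u h0 h0 h0 h0 ?_ (𝒜 := Finset.Icc B₁ Λ₁)
    (ℬ := Finset.Icc B₂ Λ₂) ?_ ?_).trans ?_
  · intro s _ t _
    rw [← pow_add, ← pow_add]
    exact pow_le_pow_of_le_one hx hx1 (perim_inter_add_perim_union_le s t)
  · exact fun A hA => Finset.mem_powerset.2
      ((Finset.mem_Icc.1 hA).2.trans Finset.subset_union_left)
  · exact fun A hA => Finset.mem_powerset.2
      ((Finset.mem_Icc.1 hA).2.trans Finset.subset_union_right)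
  · refine mul_le_mul (Finset.sum_le_sum_of_subset_of_nonneg ?_ fun _ _ _ => pow_nonneg hx _)
      (Finset.sum_le_sum_of_subset_of_nonneg ?_ fun _ _ _ => pow_nonneg hx _)
      (Finset.sum_nonneg fun _ _ => pow_nonneg hx _) (contourSum_nonneg hx _ _)
    · intro A hA
      obtain ⟨s, hs, t, ht, rfl⟩ := Finset.mem_infs.1 hA
      rw [Finset.mem_Icc] at *
      exact ⟨Finset.inter_subset_inter hs.1 ht.1, Finset.inter_subset_inter hs.2 ht.2⟩
    · intro A hA
      obtain ⟨s, hs, t, ht, rfl⟩ := Finset.mem_sups.1 hA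
      rw [Finset.mem_Icc] at *
      exact ⟨Finset.union_subset_union hs.1 ht.1, Finset.union_subset_union hs.2 ht.2⟩

lemma contourSum_map (x : ℝ) (B Λ : Finset (ℤ × ℤ)) (t : ℤ × ℤ) :
    contourSum x (B.map (addRightEmbedding t)) (Λ.map (addRightEmbedding t)) =
      contourSum x B Λ := by
  symm
  refine Finset.sum_bij (fun A _ => A.map (addRightEmbedding t)) ?_ ?_ ?_ ?_
  · intro A hA
    rw [Finset.mem_Icc] at *
    exact ⟨Finset.map_subset_map.2 hA.1, Finset.map_subset_map.2 hA.2⟩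
  · intro A _ A' _ h
    exact Finset.map_injective _ h
  · intro A hA
    rw [Finset.mem_Icc] at hA
    obtain ⟨A', -, rfl⟩ := Finset.subset_map_iff.1 hA.2
    exact ⟨A', Finset.mem_Icc.2 ⟨Finset.map_subset_map.1 hA.1, Finset.map_subset_map.1 hA.2⟩, rfl⟩
  · intro A _
    rw [perim_map_addRight]

/-- Flipping one spin changes the weight by a bounded factor. -/
lemma pow_mul_pow_perim_le {x : ℝ} (hx : 0 ≤ x) (hx1 : x ≤ 1) (A : Finset (ℤ × ℤ)) (z : ℤ × ℤ) :
    x ^ 8 * x ^ perim A ≤ x ^ perim (symmDiff A {z}) := by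
  rw [← pow_add, add_comm]
  exact pow_le_pow_of_le_one hx hx1 (perim_symmDiff_singleton_le A z)

lemma contourSum_singleton_add (x : ℝ) {z : ℤ × ℤ} {Λ : Finset (ℤ × ℤ)} :
    contourSum x {z} Λ + contourSum x ∅ (Λ \ {z}) = contourSum x ∅ Λ := by
  rw [contourSum, contourSum, contourSum,
    ← Finset.sum_filter_add_sum_filter_not (Finset.Icc ∅ Λ) (fun A => z ∈ A)]
  congr 2
  · ext A; simp [and_comm]
  · ext A
    simp only [Finset.mem_Icc, Finset.empty_subset, true_and, Finset.mem_filter,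
      Finset.subset_sdiff, Finset.disjoint_singleton_right]

lemma symmDiff_singleton_mem {z : ℤ × ℤ} {A : Finset (ℤ × ℤ)} (h : z ∈ A) :
    symmDiff A {z} = A \ {z} := by
  ext y; simp only [Finset.mem_symmDiff, Finset.mem_sdiff, Finset.mem_singleton]
  by_cases hy : y = z
  · subst hy; simp [h]
  · simp [hy]

lemma symmDiff_singleton_notMem {z : ℤ × ℤ} {A : Finset (ℤ × ℤ)} (h : z ∉ A) :
    symmDiff A {z} = A ∪ {z} := by
  ext y; simp only [Finset.mem_symmDiff, Finset.mem_union, Finset.mem_singleton]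
  by_cases hy : y = z
  · subst hy; simp [h]
  · simp [hy]

lemma pow_mul_contourSum_singleton_le {x : ℝ} (hx : 0 ≤ x) (hx1 : x ≤ 1) (z : ℤ × ℤ)
    (Λ : Finset (ℤ × ℤ)) :
    x ^ 8 * contourSum x {z} Λ ≤ contourSum x ∅ (Λ \ {z}) := by
  rw [contourSum, Finset.mul_sum]
  refine (Finset.sum_le_sum fun A _ => pow_mul_pow_perim_le hx hx1 A z).trans ?_
  rw [← Finset.sum_image (f := fun A => x ^ perim A) (g := fun A => symmDiff A {z})
    (fun A _ A' _ h => symmDiff_left_injective _ h)]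
  refine Finset.sum_le_sum_of_subset_of_nonneg ?_ fun _ _ _ => pow_nonneg hx _
  intro A hA
  obtain ⟨A', hA', rfl⟩ := Finset.mem_image.1 hA
  rw [Finset.mem_Icc] at hA' ⊢
  rw [symmDiff_singleton_mem (Finset.singleton_subset_iff.1 hA'.1)]
  exact ⟨Finset.empty_subset _, Finset.sdiff_subset_sdiff hA'.2 le_rfl⟩

lemma pow_mul_contourSum_sdiff_le {x : ℝ} (hx : 0 ≤ x) (hx1 : x ≤ 1) {z : ℤ × ℤ}
    {Λ : Finset (ℤ × ℤ)} (hz : z ∈ Λ) :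
    x ^ 8 * contourSum x ∅ (Λ \ {z}) ≤ contourSum x {z} Λ := by
  rw [contourSum, Finset.mul_sum]
  refine (Finset.sum_le_sum fun A _ => pow_mul_pow_perim_le hx hx1 A z).trans ?_
  rw [← Finset.sum_image (f := fun A => x ^ perim A) (g := fun A => symmDiff A {z})
    (fun A _ A' _ h => symmDiff_left_injective _ h)]
  refine Finset.sum_le_sum_of_subset_of_nonneg ?_ fun _ _ _ => pow_nonneg hx _
  intro A hA
  obtain ⟨A', hA', rfl⟩ := Finset.mem_image.1 hA
  rw [Finset.mem_Icc] at hA' ⊢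
  have h2 := Finset.subset_sdiff.1 hA'.2
  rw [symmDiff_singleton_notMem (Finset.disjoint_singleton_right.1 h2.2)]
  exact ⟨Finset.subset_union_right,
    Finset.union_subset h2.1 (Finset.singleton_subset_iff.2 hz)⟩

/-- The probability that all spins in `B` are plus (`b = true`) or minus (`b = false`). -/
noncomputable def blockProb (x : ℝ) (b : Bool) (B Λ : Finset (ℤ × ℤ)) : ℝ :=
  (if b then contourSum x ∅ (Λ \ B) else contourSum x B Λ) / contourSum x ∅ Λ

lemma blockProb_le_one {x : ℝ} (hx : 0 ≤ x) (b : Bool) (B Λ : Finset (ℤ × ℤ)) :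
    blockProb x b B Λ ≤ 1 := by
  refine div_le_one_of_le₀ ?_ (contourSum_nonneg hx _ _)
  cases b
  · exact contourSum_anti hx (Finset.empty_subset _)
  · exact contourSum_mono hx Finset.sdiff_subset

lemma blockProb_mul_le {x : ℝ} (hx : 0 < x) (hx1 : x ≤ 1) (b : Bool)
    (B B' Λ : Finset (ℤ × ℤ)) :
    blockProb x b B Λ * blockProb x b B' Λ ≤ blockProb x b (B ∪ B') Λ := by
  have hp := contourSum_empty_pos hx Λ
  rw [blockProb, blockProb, blockProb, div_mul_div_comm, div_le_div_iff₀ (mul_pos hp hp) hp,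
    ← mul_assoc]
  refine mul_le_mul_of_nonneg_right ?_ hp.le
  cases b
  · simp only [Bool.false_eq_true, if_false]
    refine (contourSum_mul_le hx.le hx1 _ _ _ _).trans ?_
    rw [mul_comm, Finset.inter_self, Finset.union_self]
    exact mul_le_mul_of_nonneg_left (contourSum_anti hx.le (Finset.empty_subset _))
      (contourSum_nonneg hx.le _ _)
  · simp only [if_true]
    refine (contourSum_mul_le hx.le hx1 _ _ _ _).trans ?_
    rw [Finset.inter_self, Finset.union_self, ← Finset.sdiff_union_distrib]
    exact mul_le_mul_of_nonneg_left (contourSum_mono hx.le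
      (Finset.union_subset Finset.sdiff_subset Finset.sdiff_subset))
      (contourSum_nonneg hx.le _ _)

lemma blockProb_true_anti {x : ℝ} (hx : 0 < x) (hx1 : x ≤ 1) (B : Finset (ℤ × ℤ))
    {Λ Λ' : Finset (ℤ × ℤ)} (h : Λ ⊆ Λ') :
    blockProb x true B Λ' ≤ blockProb x true B Λ := by
  rw [blockProb, blockProb, div_le_div_iff₀ (contourSum_empty_pos hx _)
    (contourSum_empty_pos hx _), mul_comm]
  simp only [if_true]
  refine (contourSum_mul_le hx.le hx1 _ _ _ _).trans ?_
  rw [Finset.inter_self, Finset.union_self]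
  have : Λ ∩ (Λ' \ B) = Λ \ B := by
    ext z; simp only [Finset.mem_inter, Finset.mem_sdiff]
    exact ⟨fun h' => ⟨h'.1, h'.2.2⟩, fun h' => ⟨h'.1, h h'.1, h'.2⟩⟩
  rw [this]
  exact mul_le_mul_of_nonneg_left (contourSum_mono hx.le
    (Finset.union_subset h Finset.sdiff_subset)) (contourSum_nonneg hx.le _ _)

lemma blockProb_false_mono {x : ℝ} (hx : 0 < x) (hx1 : x ≤ 1) (B : Finset (ℤ × ℤ))
    {Λ Λ' : Finset (ℤ × ℤ)} (h : Λ ⊆ Λ') :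
    blockProb x false B Λ ≤ blockProb x false B Λ' := by
  rw [blockProb, blockProb, div_le_div_iff₀ (contourSum_empty_pos hx _)
    (contourSum_empty_pos hx _)]
  simp only [Bool.false_eq_true, if_false]
  refine (contourSum_mul_le hx.le hx1 _ _ _ _).trans ?_
  rw [Finset.inter_empty, Finset.union_empty, Finset.inter_eq_left.2 h, Finset.union_eq_right.2 h,
    mul_comm]

lemma blockProb_map (x : ℝ) (b : Bool) (B Λ : Finset (ℤ × ℤ)) (t : ℤ × ℤ) :
    blockProb x b (B.map (addRightEmbedding t)) (Λ.map (addRightEmbedding t)) =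
      blockProb x b B Λ := by
  have h0 := contourSum_map x ∅ Λ t
  have h1 := contourSum_map x ∅ (Λ \ B) t
  rw [Finset.map_empty] at h0 h1
  rw [blockProb, blockProb, contourSum_map, h0, ← Finset.map_sdiff, h1]

lemma le_blockProb_singleton {x : ℝ} (hx : 0 < x) (hx1 : x ≤ 1) (b : Bool) {z : ℤ × ℤ}
    {Λ : Finset (ℤ × ℤ)} (hz : z ∈ Λ) : x ^ 8 / (1 + x ^ 8) ≤ blockProb x b {z} Λ := by
  have h8 : (0 : ℝ) < x ^ 8 := by positivity
  rw [blockProb, div_le_div_iff₀ (by positivity) (contourSum_empty_pos hx _),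
    ← contourSum_singleton_add x (z := z)]
  have h1 := pow_mul_contourSum_singleton_le hx.le hx1 z Λ
  have h2 := pow_mul_contourSum_sdiff_le hx.le hx1 hz
  cases b
  · simp only [Bool.false_eq_true, if_false]; linarith
  · simp only [if_true]; linarith

lemma fill_eq_minusOn {Λ A : Finset (ℤ × ℤ)} (h : A ⊆ Λ) :
    fill Λ (fun _ => true) (fun z => decide (z.1 ∉ A)) = minusOn A := by
  funext z
  by_cases hz : z ∈ Λ
  · simp [fill, minusOn, hz]
  · have : z ∉ A := fun h' => hz (h h')
    simp [fill, minusOn, hz, this]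

lemma sum_fill {M : Type*} [AddCommMonoid M] (Λ : Finset (ℤ × ℤ)) (f : Cfg2 → M) :
    ∑ τ : ↥Λ → Bool, f (fill Λ (fun _ => true) τ) = ∑ A ∈ Λ.powerset, f (minusOn A) := by
  symm
  refine Finset.sum_bij' (fun A _ => fun z : ↥Λ => decide (z.1 ∉ A))
    (fun τ _ => Λ.filter fun z => fill Λ (fun _ => true) τ z = false) ?_ ?_ ?_ ?_ ?_
  · simp
  · simp
  · intro A hA
    rw [Finset.mem_powerset] at hA
    rw [fill_eq_minusOn hA]
    ext z
    simp only [minusOn, Finset.mem_filter, decide_eq_false_iff_not, not_not]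
    exact ⟨fun h => h.2, fun h => ⟨hA h, h⟩⟩
  · intro τ _
    funext z
    simp [fill]
  · intro A hA
    rw [fill_eq_minusOn (Finset.mem_powerset.1 hA)]

lemma isingFV_apply (β : ℝ) (Λ : Finset (ℤ × ℤ)) {S : Set Cfg2} (hS : MeasurableSet S)
    [DecidablePred (· ∈ S)] :
    isingFV β 0 Λ (fun _ => true) S =
      ENNReal.ofReal ((∑ A ∈ Λ.powerset with minusOn A ∈ S, Real.exp (-2 * β) ^ perim A) /
        contourSum (Real.exp (-2 * β)) ∅ Λ) := by
  have hx := Real.exp_pos (-2 * β)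
  set x := Real.exp (-2 * β)
  set W := isingWeight β 0 Λ (fun _ => true) (minusOn ∅) with hW
  have hW0 : 0 < W := Real.exp_pos _
  have hpos : ∀ A ∈ Λ.powerset, 0 ≤ isingWeight β 0 Λ (fun _ => true) (minusOn A) :=
    fun _ _ => (Real.exp_pos _).le
  have h1 : ∑ τ : ↥Λ → Bool,
      ENNReal.ofReal (isingWeight β 0 Λ (fun _ => true) (fill Λ (fun _ => true) τ)) =
      ENNReal.ofReal (W * contourSum x ∅ Λ) := by
    rw [sum_fill Λ fun ω => ENNReal.ofReal (isingWeight β 0 Λ (fun _ => true) ω),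
      ← ENNReal.ofReal_sum_of_nonneg hpos, contourSum,
      Finset.mul_sum]
    congr 1
    refine Finset.sum_congr ?_ fun A hA => isingWeight_minusOn β (Finset.mem_Icc.1 hA).2
    ext A; simp
  have h2 : (∑ τ : ↥Λ → Bool,
      ENNReal.ofReal (isingWeight β 0 Λ (fun _ => true) (fill Λ (fun _ => true) τ)) •
        Measure.dirac (fill Λ (fun _ => true) τ)) S =
      ENNReal.ofReal (W * ∑ A ∈ Λ.powerset with minusOn A ∈ S, x ^ perim A) := by
    rw [sum_fill Λ fun ω => ENNReal.ofReal (isingWeight β 0 Λ (fun _ => true) ω) •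
        Measure.dirac ω, Measure.coe_finsetSum, Finset.sum_apply, Finset.mul_sum,
        ENNReal.ofReal_sum_of_nonneg (fun _ _ => by positivity), Finset.sum_filter]
    refine Finset.sum_congr rfl fun A hA => ?_
    rw [Measure.smul_apply, Measure.dirac_apply' _ hS, Set.indicator_apply, smul_eq_mul,
      isingWeight_minusOn β (Finset.mem_powerset.1 hA)]
    split_ifs <;> simp [hW, x]
  have hp := contourSum_empty_pos hx Λ
  rw [isingFV, h1, Measure.smul_apply, h2, smul_eq_mul, mul_comm, ← div_eq_mul_inv,
    ← ENNReal.ofReal_div_of_pos (mul_pos hW0 hp), mul_div_mul_left _ _ hW0.ne']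

lemma measurableSet_block (B : Finset (ℤ × ℤ)) (b : Bool) :
    MeasurableSet {η : Cfg2 | ∀ z ∈ B, η z = b} := by
  have : {η : Cfg2 | ∀ z ∈ B, η z = b} = ⋂ z ∈ B, (fun η : Cfg2 => η z) ⁻¹' {b} := by
    ext; simp
  rw [this]
  exact Finset.measurableSet_biInter _ fun z _ => measurable_pi_apply z (measurableSet_singleton b)

lemma isingFV_block (β : ℝ) (B Λ : Finset (ℤ × ℤ)) (b : Bool) :
    isingFV β 0 Λ (fun _ => true) {η | ∀ z ∈ B, η z = b} =
      ENNReal.ofReal (blockProb (Real.exp (-2 * β)) b B Λ) := by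
  classical
  rw [isingFV_apply β Λ (measurableSet_block B b), blockProb]
  congr 2
  cases b
  · simp only [Bool.false_eq_true, if_false]
    refine Finset.sum_congr ?_ fun _ _ => rfl
    ext A
    simp [minusOn, Finset.subset_iff, and_comm]
  · simp only [if_true]
    refine Finset.sum_congr ?_ fun _ _ => rfl
    ext A
    simp only [minusOn, Set.mem_ofPred_eq, Finset.mem_filter, Finset.mem_powerset,
      decide_eq_true_eq, Finset.mem_Icc, Finset.empty_subset, true_and, Finset.subset_sdiff,
      Finset.disjoint_right]

/-- The sites `(-n, 0), …, (-1, 0)`. -/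
noncomputable def segment (n : ℕ) : Finset (ℤ × ℤ) := Finset.Icc (-(n : ℤ)) (-1) ×ˢ {0}

lemma schonmann_allBlock (μ : Measure Cfg2) (n : ℕ) (b : Bool) :
    schonmann μ (allBlock n b) = μ {η | ∀ z ∈ segment n, η z = b} := by
  have hm : Measurable lineProj := measurable_pi_lambda _ fun i => measurable_pi_apply _
  have hs : MeasurableSet (allBlock n b) := by
    have : allBlock n b = ⋂ i ∈ Finset.Icc (-(n : ℤ)) (-1), (fun η : ZSeq Bool => η i) ⁻¹' {b} := by
      ext; simp [allBlock]
    rw [this]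
    exact Finset.measurableSet_biInter _
      fun z _ => measurable_pi_apply z (measurableSet_singleton b)
  rw [schonmann, Measure.map_apply hm hs]
  congr 1
  ext η
  simp only [allBlock, segment, Set.mem_ofPred_eq, Finset.mem_product, Finset.mem_Icc,
    Finset.mem_singleton, Prod.forall]
  exact ⟨fun h a b hab => hab.2 ▸ h a hab.1.1 hab.1.2, fun h i h1 h2 => h i 0 ⟨⟨h1, h2⟩, rfl⟩⟩

section limit

variable {β : ℝ} {μ : Measure Cfg2}

lemma tendsto_blockProb (h : IsPlusPhase β 0 μ) (b : Bool) (B : Finset (ℤ × ℤ)) :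
    Tendsto (fun N => blockProb (Real.exp (-2 * β)) b B (box N)) atTop
      (𝓝 (μ {η | ∀ z ∈ B, η z = b}).toReal) := by
  have := h.1
  have h1 := h.2 B fun _ => b
  simp only [isingFV_block] at h1
  have h2 := (ENNReal.tendsto_toReal (measure_ne_top μ _)).comp h1
  refine h2.congr fun N => ENNReal.toReal_ofReal ?_
  rw [blockProb]
  refine div_nonneg ?_ (contourSum_nonneg (Real.exp_pos _).le _ _)
  split_ifs <;> exact contourSum_nonneg (Real.exp_pos _).le _ _

lemma mem_box {N : ℕ} {z : ℤ × ℤ} : z ∈ box N ↔ |z.1| ≤ N ∧ |z.2| ≤ N := by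
  simp [box, abs_le]

lemma measure_block_map (h : IsPlusPhase β 0 μ) (hβ : 0 ≤ β) (b : Bool) (B : Finset (ℤ × ℤ))
    (k : ℕ) :
    (μ {η | ∀ z ∈ B.map (addRightEmbedding (-(k : ℤ), 0)), η z = b}).toReal =
      (μ {η | ∀ z ∈ B, η z = b}).toReal := by
  have hx := Real.exp_pos (-2 * β)
  have hx1 : Real.exp (-2 * β) ≤ 1 := Real.exp_le_one_iff.2 (by linarith)
  set x := Real.exp (-2 * β)
  set t : ℤ × ℤ := (-(k : ℤ), 0)
  have s1 : ∀ N, (box N).map (addRightEmbedding t) ⊆ box (N + k) := by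
    intro N z hz
    obtain ⟨y, hy, rfl⟩ := Finset.mem_map.1 hz
    rw [mem_box, abs_le, abs_le] at *
    simp [t]
    omega
  have s2 : ∀ N, box N ⊆ (box (N + k)).map (addRightEmbedding t) := by
    intro N z hz
    refine Finset.mem_map.2 ⟨z - t, ?_, by simp⟩
    rw [mem_box, abs_le, abs_le] at *
    simp [t]
    omega
  have l0 := tendsto_blockProb h b B
  have l0' := (tendsto_add_atTop_iff_nat k).2 l0
  have l1 := tendsto_blockProb h b (B.map (addRightEmbedding t))
  have l1' := (tendsto_add_atTop_iff_nat k).2 l1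
  cases b
  · apply le_antisymm
    · refine le_of_tendsto_of_tendsto' l1 l0' fun N => ?_
      exact (blockProb_false_mono hx hx1 _ (s2 N)).trans_eq (blockProb_map x _ _ _ _)
    · refine le_of_tendsto_of_tendsto' l0 l1' fun N => ?_
      exact (blockProb_map x _ _ _ _).symm.trans_le (blockProb_false_mono hx hx1 _ (s1 N))
  · apply le_antisymm
    · refine le_of_tendsto_of_tendsto' l1' l0 fun N => ?_
      exact (blockProb_true_anti hx hx1 _ (s1 N)).trans_eq (blockProb_map x _ _ _ _)
    · refine le_of_tendsto_of_tendsto' l0' l1 fun N => ?_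
      exact (blockProb_map x _ _ _ _).symm.trans_le (blockProb_true_anti hx hx1 _ (s2 N))

lemma segment_add (m n : ℕ) :
    segment (m + n) = segment m ∪ (segment n).map (addRightEmbedding (-(m : ℤ), 0)) := by
  ext ⟨a, b⟩
  simp only [segment, Finset.mem_union, Finset.mem_map, Finset.mem_product, Finset.mem_Icc,
    Finset.mem_singleton, addRightEmbedding_apply, Prod.exists, Prod.mk_add_mk, Prod.mk.injEq,
    add_zero]
  constructor
  · rintro ⟨⟨h1, h2⟩, rfl⟩
    by_cases h : -(m : ℤ) ≤ a
    · exact Or.inl ⟨⟨h, h2⟩, rfl⟩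
    · exact Or.inr ⟨a + m, 0, ⟨⟨by push_cast at h1; omega, by omega⟩, rfl⟩, by omega, rfl⟩
  · rintro (⟨⟨h1, h2⟩, rfl⟩ | ⟨c, d, ⟨⟨h1, h2⟩, rfl⟩, h3, h4⟩)
    · exact ⟨⟨by push_cast; omega, h2⟩, rfl⟩
    · exact ⟨⟨by push_cast; omega, by omega⟩, h4.symm⟩

lemma measure_segment_mul_le (h : IsPlusPhase β 0 μ) (hβ : 0 ≤ β) (b : Bool) (m n : ℕ) :
    (μ {η | ∀ z ∈ segment m, η z = b}).toReal * (μ {η | ∀ z ∈ segment n, η z = b}).toReal ≤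
      (μ {η | ∀ z ∈ segment (m + n), η z = b}).toReal := by
  have hx1 : Real.exp (-2 * β) ≤ 1 := Real.exp_le_one_iff.2 (by linarith)
  rw [← measure_block_map h hβ b (segment n) m, segment_add]
  exact le_of_tendsto_of_tendsto' ((tendsto_blockProb h b _).mul (tendsto_blockProb h b _))
    (tendsto_blockProb h b _) fun N => blockProb_mul_le (Real.exp_pos _) hx1 _ _ _ _

lemma measure_segment_le_one (h : IsPlusPhase β 0 μ) (b : Bool) (n : ℕ) :
    (μ {η | ∀ z ∈ segment n, η z = b}).toReal ≤ 1 :=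
  le_of_tendsto' (tendsto_blockProb h b _) fun _ => blockProb_le_one (Real.exp_pos _).le _ _ _

lemma measure_segment_pos (h : IsPlusPhase β 0 μ) (hβ : 0 ≤ β) (b : Bool) (n : ℕ) :
    0 < (μ {η | ∀ z ∈ segment n, η z = b}).toReal := by
  have := h.1
  have hx := Real.exp_pos (-2 * β)
  have hx1 : Real.exp (-2 * β) ≤ 1 := Real.exp_le_one_iff.2 (by linarith)
  induction n with
  | zero => simp [segment]
  | succ n ih =>
    refine lt_of_lt_of_le (mul_pos ih ?_) (measure_segment_mul_le h hβ b n 1)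
    refine lt_of_lt_of_le (b := Real.exp (-2 * β) ^ 8 / (1 + Real.exp (-2 * β) ^ 8))
      (by positivity) (ge_of_tendsto (tendsto_blockProb h b _) ?_)
    filter_upwards [eventually_ge_atTop 1] with N hN
    have e : segment 1 = {(-1, 0)} := by
      ext ⟨a, c⟩; simp [segment, le_antisymm_iff, and_comm]
    rw [e]
    refine le_blockProb_singleton hx hx1 b ?_
    rw [mem_box]
    simp
    exact_mod_cast hN

/-- The exponential rate of the block events exists. -/
lemma exists_rate (h : IsPlusPhase β 0 μ) (hβ : 0 ≤ β) (b : Bool) :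
    ∃ θ : ℝ, Tendsto (fun n : ℕ =>
      -(Real.log (μ {η | ∀ z ∈ segment n, η z = b}).toReal) / n) atTop (𝓝 θ) := by
  have hs : Subadditive fun n : ℕ => -(Real.log (μ {η | ∀ z ∈ segment n, η z = b}).toReal) := by
    intro m n
    have h1 := Real.log_le_log (mul_pos (measure_segment_pos h hβ b m)
      (measure_segment_pos h hβ b n)) (measure_segment_mul_le h hβ b m n)
    rw [Real.log_mul (measure_segment_pos h hβ b m).ne' (measure_segment_pos h hβ b n).ne'] at h1
    simp only
    linarith
  refine ⟨_, hs.tendsto_lim ⟨0, ?_⟩⟩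
  rintro _ ⟨n, rfl⟩
  exact div_nonneg (neg_nonneg.2 (Real.log_nonpos ENNReal.toReal_nonneg
    (measure_segment_le_one h b n))) n.cast_nonneg

/-- An exponential bound on the ratio of block probabilities separates the rates. -/
lemma rate_lt_of_contourSum_le (h : IsPlusPhase β 0 μ) (hβ : 0 ≤ β) {C ρ : ℝ} (hC : 0 < C)
    (hρ : 0 < ρ) (hρ1 : ρ < 1) (hb : ∀ n N : ℕ, n < N →
      contourSum (Real.exp (-2 * β)) (segment n) (box N) ≤
        C * ρ ^ n * contourSum (Real.exp (-2 * β)) ∅ (box N \ segment n)) :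
    ∃ θp θm : ℝ,
      Tendsto (fun n : ℕ =>
          -(Real.log ((schonmann μ) (allBlock n false)).toReal) / n) atTop (𝓝 θp) ∧
      Tendsto (fun n : ℕ =>
          -(Real.log ((schonmann μ) (allBlock n true)).toReal) / n) atTop (𝓝 θm) ∧
      θm < θp := by
  simp only [schonmann_allBlock]
  obtain ⟨θp, hp⟩ := exists_rate h hβ false
  obtain ⟨θm, hm⟩ := exists_rate h hβ true
  refine ⟨θp, θm, hp, hm, ?_⟩
  have key : ∀ n : ℕ, (μ {η | ∀ z ∈ segment n, η z = false}).toReal ≤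
      C * ρ ^ n * (μ {η | ∀ z ∈ segment n, η z = true}).toReal := by
    intro n
    refine le_of_tendsto_of_tendsto (tendsto_blockProb h _ _)
      ((tendsto_blockProb h _ _).const_mul _) ?_
    filter_upwards [eventually_gt_atTop n] with N hN
    rw [blockProb, blockProb, ← mul_div_assoc]
    exact div_le_div_of_nonneg_right (hb n N hN) (contourSum_nonneg (Real.exp_pos _).le _ _)
  have hl : Tendsto (fun n : ℕ => -(Real.log C) / n - Real.log ρ +
      -(Real.log (μ {η | ∀ z ∈ segment n, η z = true}).toReal) / n) atTop
      (𝓝 (0 - Real.log ρ + θm)) :=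
    ((tendsto_const_nhds.div_atTop tendsto_natCast_atTop_atTop).sub_const _).add hm
  have hle : 0 - Real.log ρ + θm ≤ θp := by
    refine le_of_tendsto_of_tendsto hl hp ?_
    filter_upwards [eventually_gt_atTop 0] with n hn
    have hn' : (0 : ℝ) < n := by exact_mod_cast hn
    have h1 := Real.log_le_log (measure_segment_pos h hβ false n) (key n)
    rw [Real.log_mul (by positivity) (measure_segment_pos h hβ true n).ne',
      Real.log_mul hC.ne' (by positivity), Real.log_pow] at h1
    rw [div_sub' hn'.ne', ← add_div]
    gcongr
    linarith
  have := Real.log_neg hρ hρ1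
  linarith

end limit

/-- Bonds of `ℤ²`, given by their direction (`true` for vertical) and their lower left endpoint. -/
abbrev Bond := Bool × (ℤ × ℤ)

/-- The upper right endpoint of a bond. -/
def tgt (e : Bond) : ℤ × ℤ := if e.1 then (e.2.1, e.2.2 + 1) else (e.2.1 + 1, e.2.2)

/-- The bonds whose lower left endpoint lies in `box m`. -/
noncomputable def bonds (m : ℕ) : Finset Bond := Finset.univ ×ˢ box m

lemma mem_bonds {m : ℕ} {e : Bond} : e ∈ bonds m ↔ e.2 ∈ box m := by
  simp [bonds]

/-- Whether a bond separates `A` from its complement. -/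
def cut (A : Finset (ℤ × ℤ)) (e : Bond) : Bool := xor (decide (e.2 ∈ A)) (decide (tgt e ∈ A))

/-- The spin at `p` when `A` is the set of minus spins. -/
noncomputable def spin (A : Finset (ℤ × ℤ)) (p : ℤ × ℤ) : ℝ := if p ∈ A then -1 else 1

/-- The weight of the spin configuration with minus set `A`, bond weights `w` and disorder `D`. -/
noncomputable def wt (m : ℕ) (w : Bond → ℝ) (D : Bond → Bool) (A : Finset (ℤ × ℤ)) : ℝ :=
  ∏ e ∈ bonds m, if xor (cut A e) (D e) then w e else 1

/-- The unnormalised two-point function in the presence of the disorder `D`. -/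
noncomputable def corr (m : ℕ) (w : Bond → ℝ) (D : Bond → Bool) (p q : ℤ × ℤ) : ℝ :=
  ∑ A ∈ (box m).powerset, wt m w D A * (spin A p * spin A q)

/-- The partition function with bond weights `w`. -/
noncomputable def partFun (m : ℕ) (w : Bond → ℝ) : ℝ :=
  ∑ A ∈ (box m).powerset, wt m w (fun _ => false) A

lemma spin_symmDiff (A B : Finset (ℤ × ℤ)) (p : ℤ × ℤ) :
    spin (symmDiff A B) p = spin A p * spin B p := by
  by_cases h : p ∈ A <;> by_cases h' : p ∈ B <;> simp [spin, Finset.mem_symmDiff, h, h']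

lemma spin_mul_self (A : Finset (ℤ × ℤ)) (p : ℤ × ℤ) : spin A p * spin A p = 1 := by
  unfold spin; split_ifs <;> norm_num

lemma cut_symmDiff (A B : Finset (ℤ × ℤ)) (e : Bond) :
    cut (symmDiff A B) e = xor (cut A e) (cut B e) := by
  by_cases h1 : e.2 ∈ A <;> by_cases h2 : e.2 ∈ B <;> by_cases h3 : tgt e ∈ A <;>
    by_cases h4 : tgt e ∈ B <;> simp [cut, Finset.mem_symmDiff, h1, h2, h3, h4]

/-- Gauge covariance of the two-point function. -/
lemma corr_gauge {m : ℕ} (w : Bond → ℝ) {D D' : Bond → Bool} {B : Finset (ℤ × ℤ)}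
    (hB : B ⊆ box m) (h : ∀ e ∈ bonds m, D' e = xor (D e) (cut B e)) (p q : ℤ × ℤ) :
    corr m w D' p q = spin B p * spin B q * corr m w D p q := by
  rw [corr, corr, Finset.mul_sum]
  have hsub : ∀ A ∈ (box m).powerset, symmDiff A B ∈ (box m).powerset := by
    intro A hA
    rw [Finset.mem_powerset] at *
    intro z hz
    rcases Finset.mem_symmDiff.1 hz with hz | hz
    · exact hA hz.1
    · exact hB hz.1
  refine Finset.sum_bij' (fun A _ => symmDiff A B) (fun A _ => symmDiff A B) hsub hsub
    (fun A _ => symmDiff_symmDiff_cancel_right _ _)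
    (fun A _ => symmDiff_symmDiff_cancel_right _ _) ?_
  intro A _
  have hw : wt m w D (symmDiff A B) = wt m w D' A := by
    refine Finset.prod_congr rfl fun e he => ?_
    rw [h e he, cut_symmDiff]
    congr 2
    cases cut A e <;> cases cut B e <;> cases D e <;> rfl
  rw [hw, spin_symmDiff, spin_symmDiff]
  linear_combination (-(wt m w D' A * spin A p * spin A q)) *
    (spin B p * spin B p * spin_mul_self B q + spin_mul_self B p)

/-- The effect of toggling the disorder at a single bond. -/
lemma corr_toggle {m : ℕ} (w : Bond → ℝ) {D D' : Bond → Bool} {e : Bond} (he : e ∈ bonds m)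
    (h : ∀ f ∈ bonds m, f ≠ e → D' f = D f) (hne : D' e = !D e) {η : ℝ}
    (hη : η = if D e then -1 else 1) (z : ℤ × ℤ) :
    corr m w D e.2 z - η * corr m w D (tgt e) z =
      w e * (corr m w D' e.2 z - η * corr m w D' (tgt e) z) := by
  simp only [corr, Finset.mul_sum, ← Finset.sum_sub_distrib]
  refine Finset.sum_congr rfl fun A _ => ?_
  have h1 : ∀ D : Bond → Bool, wt m w D A = (if xor (cut A e) (D e) then w e else 1) *
      ∏ f ∈ (bonds m).erase e, if xor (cut A f) (D f) then w f else 1 := fun D =>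
    (Finset.mul_prod_erase _ _ he).symm
  have h2 : (∏ f ∈ (bonds m).erase e, if xor (cut A f) (D' f) then w f else 1) =
      ∏ f ∈ (bonds m).erase e, if xor (cut A f) (D f) then w f else 1 :=
    Finset.prod_congr rfl fun f hf => by
      rw [h f (Finset.mem_of_mem_erase hf) (Finset.ne_of_mem_erase hf)]
  rw [h1 D, h1 D', h2, hne, hη]
  generalize (∏ f ∈ (bonds m).erase e, if xor (cut A f) (D f) then w f else 1) = g
  generalize spin A z = s
  by_cases a : e.2 ∈ A <;> by_cases b : tgt e ∈ A <;> cases D e <;> simp [cut, spin, a, b] <;> ring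

/-- The vertical bonds in row `v.2` from the far left up to column `v.1`: a disorder line ending
at the face with lower left corner `v`. -/
def ray (v : ℤ × ℤ) (e : Bond) : Bool := e.1 && (decide (e.2.2 = v.2) && decide (e.2.1 ≤ v.1))

/-- The disorder with endpoints at the faces `v` and `(c, -1)`. -/
def line (c : ℤ) (v : ℤ × ℤ) (e : Bond) : Bool := xor (ray v e) (ray (c, -1) e)

/-- The sign which makes the fermionic observable satisfy local relations. -/
noncomputable def gaugeSign (c b : ℤ) (p : ℤ × ℤ) : ℝ :=
  if 0 ≤ b ∨ (b = -1 ∧ p.2 = 0 ∧ p.1 ≤ c) then -1 else 1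

/-- The fermionic observable at the corner `p` of the face `v`, with source at the
bond from `(c, 0)` to `(c + 1, 0)`. -/
noncomputable def obs (m : ℕ) (w : Bond → ℝ) (c : ℤ) (v p : ℤ × ℤ) : ℝ :=
  gaugeSign c v.2 p * corr m w (line c v) p (c, 0)

lemma obs_vertical_left {m : ℕ} (w : Bond → ℝ) (c : ℤ) {a b : ℤ} (h : (a, b) ∈ box m) :
    obs m w c (a - 1, b) (a, b) - obs m w c (a - 1, b) (a, b + 1) =
      w (true, (a, b)) * (obs m w c (a, b) (a, b) - obs m w c (a, b) (a, b + 1)) := by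
  have hc := corr_toggle w (D := line c (a - 1, b)) (D' := line c (a, b)) (e := (true, (a, b)))
    (mem_bonds.2 h) ?_ ?_ rfl (c, 0)
  · simp only [tgt, line, ray, if_true, Bool.true_and] at hc
    simp only [obs, gaugeSign]
    by_cases hb : b = -1
    · subst hb
      by_cases ha : a ≤ c
      · simp [ha] at hc ⊢
        linear_combination hc
      · simp [ha] at hc ⊢
        linear_combination hc
    · simp [hb] at hc ⊢
      split_ifs
      · linear_combination -hc
      · linear_combination hc
  · rintro ⟨d, a', b'⟩ _ hne
    cases d
    · simp [line, ray]
    · simp only [ne_eq, Prod.mk.injEq, true_and, not_and] at hne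
      simp only [line, ray, Bool.true_and]
      congr 1
      rw [← Bool.decide_and, ← Bool.decide_and, decide_eq_decide]
      constructor
      · rintro ⟨h1, h2⟩; exact ⟨h1, by have := fun h => hne h h1; omega⟩
      · rintro ⟨h1, h2⟩; exact ⟨h1, by omega⟩
  · simp [line, ray]

lemma obs_vertical_right {m : ℕ} (w : Bond → ℝ) (c : ℤ) {a b : ℤ} (h : (a, b) ∈ box m) :
    obs m w c (a, b) (a, b) + obs m w c (a, b) (a, b + 1) =
      w (true, (a, b)) * (obs m w c (a - 1, b) (a, b) + obs m w c (a - 1, b) (a, b + 1)) := by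
  have hc := corr_toggle w (D := line c (a, b)) (D' := line c (a - 1, b)) (e := (true, (a, b)))
    (mem_bonds.2 h) ?_ ?_ rfl (c, 0)
  · simp only [tgt, line, ray, if_true, Bool.true_and] at hc
    simp only [obs, gaugeSign]
    by_cases hb : b = -1
    · subst hb
      by_cases ha : a ≤ c
      · simp [ha] at hc ⊢
        linear_combination hc
      · simp [ha] at hc ⊢
        linear_combination hc
    · simp [hb] at hc ⊢
      split_ifs
      · linear_combination -hc
      · linear_combination hc
  · rintro ⟨d, a', b'⟩ _ hne
    cases d
    · simp [line, ray]
    · simp only [ne_eq, Prod.mk.injEq, true_and, not_and] at hne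
      simp only [line, ray, Bool.true_and]
      congr 1
      rw [← Bool.decide_and, ← Bool.decide_and, decide_eq_decide]
      constructor
      · rintro ⟨h1, h2⟩; exact ⟨h1, by omega⟩
      · rintro ⟨h1, h2⟩; exact ⟨h1, by have := fun h => hne h h1; omega⟩
  · simp [line, ray]

lemma line_row {m : ℕ} (c : ℤ) {a b : ℤ} (ha : -(m : ℤ) ≤ a) {e : Bond} (he : e ∈ bonds m) :
    line c (a, b) e = xor (xor (line c (a, b - 1) e) (decide (e = (false, (a, b)))))
      (cut (Finset.Icc (-(m : ℤ)) a ×ˢ {b}) e) := by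
  obtain ⟨d, a', b'⟩ := e
  rw [mem_bonds, mem_box, abs_le, abs_le] at he
  obtain ⟨⟨h1, h2⟩, -⟩ := he
  dsimp only at h1 h2
  rw [Bool.eq_iff_iff]
  cases d
  · simp only [line, ray, cut, tgt, Finset.mem_product, Finset.mem_Icc, Finset.mem_singleton,
      Prod.mk.injEq, Bool.false_and, Bool.false_eq_true, if_false, true_and]
    have h7 : -(m : ℤ) ≤ a' + 1 := by omega
    by_cases h3 : a' ≤ a <;> by_cases h4 : b' = b <;> by_cases h5 : a' = a <;>
      by_cases h6 : a' + 1 ≤ a <;> first | omega | simp [h1, h3, h4, h5, h6, h7, ha]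
  · simp only [line, ray, cut, tgt, Finset.mem_product, Finset.mem_Icc, Finset.mem_singleton,
      Prod.mk.injEq, Bool.true_and, if_true, reduceCtorEq, false_and, decide_false,
      Bool.xor_false]
    generalize (decide (b' = -1) && decide (a' ≤ c)) = r
    have h7 : b' + 1 = b ↔ b' = b - 1 := by omega
    simp only [h7]
    generalize hs : decide (b' = b - 1) = s
    generalize ht : decide (b' = b) = t
    by_cases h3 : a' ≤ a <;> cases r <;> cases s <;> cases t <;> simp_all

/-- The disorder across a horizontal bond, in the gauge of the face above it. -/
lemma corr_line_above {m : ℕ} (w : Bond → ℝ) {c : ℤ} {a b : ℤ} (h : (a, b) ∈ box m)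
    (p q : ℤ × ℤ) :
    corr m w (line c (a, b)) p q = spin (Finset.Icc (-(m : ℤ)) a ×ˢ {b}) p *
      spin (Finset.Icc (-(m : ℤ)) a ×ˢ {b}) q *
      corr m w (fun e => xor (line c (a, b - 1) e) (decide (e = (false, (a, b))))) p q := by
  rw [mem_box, abs_le, abs_le] at h
  refine corr_gauge w ?_ (fun e he => line_row c h.1.1 he) p q
  rintro ⟨a', b'⟩ hz
  simp only [Finset.mem_product, Finset.mem_Icc, Finset.mem_singleton] at hz
  rw [mem_box, abs_le, abs_le]
  dsimp only at *
  omega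

lemma corr_line_below {m : ℕ} (w : Bond → ℝ) {c : ℤ} {a b : ℤ} (h : (a, b) ∈ box m)
    (p q : ℤ × ℤ) :
    corr m w (line c (a, b - 1)) p q = spin (Finset.Icc (-(m : ℤ)) a ×ˢ {b}) p *
      spin (Finset.Icc (-(m : ℤ)) a ×ˢ {b}) q *
      corr m w (fun e => xor (line c (a, b) e) (decide (e = (false, (a, b))))) p q := by
  rw [mem_box, abs_le, abs_le] at h
  refine corr_gauge w ?_ (fun e he => ?_) p q
  · rintro ⟨a', b'⟩ hz
    simp only [Finset.mem_product, Finset.mem_Icc, Finset.mem_singleton] at hz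
    rw [mem_box, abs_le, abs_le]
    dsimp only at *
    omega
  · have := line_row c (b := b) h.1.1 he
    dsimp only at this
    rw [this]
    cases line c (a, b - 1) e <;> cases decide (e = (false, (a, b))) <;>
      cases cut (Finset.Icc (-(m : ℤ)) a ×ˢ {b}) e <;> rfl

/-- The relation between the gauge signs of the faces below and above a horizontal bond. -/
lemma gaugeSign_below (m : ℕ) {c : ℤ} (hc : (c, 0) ∈ box m) (a b : ℤ) {p : ℤ × ℤ} (hp : p.2 = b)
    (hpa : p.1 = a ∨ p.1 = a + 1) (hne : ¬ (b = 0 ∧ a = c ∧ p.1 = a)) :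
    gaugeSign c (b - 1) p =
      spin (Finset.Icc (-(m : ℤ)) a ×ˢ {b}) (c, 0) * gaugeSign c b p := by
  rw [mem_box, abs_le, abs_le] at hc
  obtain ⟨⟨h1, h2⟩, -⟩ := hc
  simp only [gaugeSign, spin, Finset.mem_product, Finset.mem_Icc, Finset.mem_singleton]
  dsimp only at *
  split_ifs <;> first | omega | norm_num

lemma corr_line_self (m : ℕ) (w : Bond → ℝ) (c : ℤ) (p : ℤ × ℤ) :
    corr m w (line c (c, -1)) p p = partFun m w := by
  refine Finset.sum_congr rfl fun A _ => ?_
  rw [spin_mul_self, mul_one]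
  exact Finset.prod_congr rfl fun e _ => by simp [line]

lemma obs_horizontal_below {m : ℕ} (w : Bond → ℝ) {c : ℤ} (hc : (c, 0) ∈ box m) {a b : ℤ}
    (h : (a, b) ∈ box m) :
    obs m w c (a, b - 1) (a, b) - obs m w c (a, b - 1) (a + 1, b) =
      -w (false, (a, b)) * (obs m w c (a, b) (a, b) + obs m w c (a, b) (a + 1, b)) -
      (if a = c ∧ b = 0 then 2 * partFun m w else 0) := by
  have ht := corr_toggle w (D := line c (a, b - 1))
    (D' := fun e => xor (line c (a, b - 1) e) (decide (e = (false, (a, b)))))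
    (e := (false, (a, b))) (mem_bonds.2 h) (fun f _ hf => by simp [hf]) (by simp) rfl (c, 0)
  have h0 : line c (a, b - 1) (false, (a, b)) = false := by simp [line, ray]
  simp only [h0, tgt, Bool.false_eq_true, if_false, one_mul] at ht
  have h1 := corr_line_above w (c := c) h (a, b) (c, 0)
  have h2 := corr_line_above w (c := c) h (a + 1, b) (c, 0)
  have sp : spin (Finset.Icc (-(m : ℤ)) a ×ˢ {b}) (a, b) = -1 := by
    have := (mem_box.1 h).1
    rw [abs_le] at this
    simp [spin, this.1]
  have sq : spin (Finset.Icc (-(m : ℤ)) a ×ˢ {b}) (a + 1, b) = 1 := by simp [spin]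
  have hg : gaugeSign c b (a + 1, b) = gaugeSign c b (a, b) := by
    simp only [gaugeSign]
    split_ifs <;> first | omega | rfl
  have hs := spin_mul_self (Finset.Icc (-(m : ℤ)) a ×ˢ {b}) (c, 0)
  rw [sp] at h1
  rw [sq] at h2
  have gq := gaugeSign_below m hc a b (p := (a + 1, b)) rfl (Or.inr rfl)
    (fun h => by have := h.2.2; dsimp only at this; omega)
  by_cases hsrc : a = c ∧ b = 0
  · obtain ⟨rfl, rfl⟩ := hsrc
    rw [sp] at h1 h2
    have := corr_line_self m w a (a, 0)
    simp only [obs, gaugeSign, h1, h2]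
    simp [-neg_add_rev] at ht this ⊢
    linear_combination ht - 2 * this
  · have gp := gaugeSign_below m hc a b (p := (a, b)) rfl (Or.inl rfl)
      (fun h => hsrc ⟨h.2.1, h.1⟩)
    simp only [obs, h1, h2, gp, gq, hg, if_neg hsrc]
    linear_combination (spin (Finset.Icc (-(m : ℤ)) a ×ˢ {b}) (c, 0) * gaugeSign c b (a, b)) * ht

lemma obs_horizontal_above {m : ℕ} (w : Bond → ℝ) {c : ℤ} (hc : (c, 0) ∈ box m) {a b : ℤ}
    (h : (a, b) ∈ box m) :
    obs m w c (a, b) (a, b) - obs m w c (a, b) (a + 1, b) =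
      -w (false, (a, b)) * (obs m w c (a, b - 1) (a, b) + obs m w c (a, b - 1) (a + 1, b)) -
      (if a = c ∧ b = 0 then 2 * w (false, (a, b)) * partFun m w else 0) := by
  have ht := corr_toggle w (D := line c (a, b))
    (D' := fun e => xor (line c (a, b) e) (decide (e = (false, (a, b)))))
    (e := (false, (a, b))) (mem_bonds.2 h) (fun f _ hf => by simp [hf]) (by simp) rfl (c, 0)
  have h0 : line c (a, b) (false, (a, b)) = false := by simp [line, ray]
  simp only [h0, tgt, Bool.false_eq_true, if_false, one_mul] at ht
  have h1 := corr_line_below w (c := c) h (a, b) (c, 0)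
  have h2 := corr_line_below w (c := c) h (a + 1, b) (c, 0)
  have sp : spin (Finset.Icc (-(m : ℤ)) a ×ˢ {b}) (a, b) = -1 := by
    have := (mem_box.1 h).1
    rw [abs_le] at this
    simp [spin, this.1]
  have sq : spin (Finset.Icc (-(m : ℤ)) a ×ˢ {b}) (a + 1, b) = 1 := by simp [spin]
  have hg : gaugeSign c b (a + 1, b) = gaugeSign c b (a, b) := by
    simp only [gaugeSign]
    split_ifs <;> first | omega | rfl
  have hs := spin_mul_self (Finset.Icc (-(m : ℤ)) a ×ˢ {b}) (c, 0)
  rw [sp] at h1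
  rw [sq] at h2
  have gq := gaugeSign_below m hc a b (p := (a + 1, b)) rfl (Or.inr rfl)
    (fun h => by have := h.2.2; dsimp only at this; omega)
  by_cases hsrc : a = c ∧ b = 0
  · obtain ⟨rfl, rfl⟩ := hsrc
    rw [sp] at h1 h2
    have := corr_line_self m w a (a, 0)
    simp only [obs, gaugeSign]
    simp [-neg_add_rev] at ht this h1 h2 ⊢
    rw [← h1] at ht
    rw [h2]
    linear_combination -ht - 2 * w (false, (a, 0)) * this
  · have gp := gaugeSign_below m hc a b (p := (a, b)) rfl (Or.inl rfl)
      (fun h => hsrc ⟨h.2.1, h.1⟩)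
    simp only [obs, h1, h2, gp, gq, hg, if_neg hsrc]
    linear_combination gaugeSign c b (a, b) * ht - gaugeSign c b (a, b) * w (false, (a, b)) *
      (corr m w (fun e => xor (line c (a, b) e) (decide (e = (false, (a, b))))) (a, b) (c, 0) -
      corr m w (fun e => xor (line c (a, b) e) (decide (e = (false, (a, b))))) (a + 1, b) (c, 0)) *
      hs

/-- The partial derivative of the partition function with respect to the weight of the bond `e`. -/
noncomputable def partFunDeriv (m : ℕ) (w : Bond → ℝ) (e : Bond) : ℝ :=
  ∑ A ∈ (box m).powerset, if cut A e then
    ∏ f ∈ (bonds m).erase e, if cut A f then w f else 1 else 0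

lemma obs_source {m : ℕ} (w : Bond → ℝ) {c : ℤ} (hc : (c, 0) ∈ box m) :
    obs m w c (c, 0) (c, 0) + obs m w c (c, 0) (c + 1, 0) =
      -2 * partFunDeriv m w (false, (c, 0)) := by
  have h1 := corr_line_above w (c := c) hc (c, 0) (c, 0)
  have h2 := corr_line_above w (c := c) hc (c + 1, 0) (c, 0)
  have sp : spin (Finset.Icc (-(m : ℤ)) c ×ˢ {0}) (c, 0) = -1 := by
    have := (mem_box.1 hc).1
    rw [abs_le] at this
    simp [spin, this.1]
  have sq : spin (Finset.Icc (-(m : ℤ)) c ×ˢ {0}) (c + 1, 0) = 1 := by simp [spin]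
  rw [sp] at h1 h2
  rw [sq] at h2
  simp only [obs, gaugeSign, h1, h2]
  simp only [le_refl, true_or, if_true, corr, partFunDeriv, Finset.mul_sum,
    ← Finset.sum_add_distrib]
  refine Finset.sum_congr rfl fun A _ => ?_
  rw [wt, ← Finset.mul_prod_erase _ _ (mem_bonds.2 hc : (false, (c, 0)) ∈ bonds m)]
  have : ∏ f ∈ (bonds m).erase (false, (c, 0)),
      (if xor (cut A f) (xor (line c (c, 0 - 1) f) (decide (f = (false, (c, 0))))) then w f else 1)
      = ∏ f ∈ (bonds m).erase (false, (c, 0)), if cut A f then w f else 1 :=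
    Finset.prod_congr rfl fun f hf => by simp [line, Finset.ne_of_mem_erase hf]
  rw [this]
  generalize (∏ f ∈ (bonds m).erase (false, (c, 0)), if cut A f then w f else 1) = g
  by_cases a : (c, (0 : ℤ)) ∈ A <;> by_cases b : (c + 1, (0 : ℤ)) ∈ A <;>
    simp [cut, tgt, spin, line, a, b] <;> ring

/-- The bonds which join two sites of `box m`, not both on its boundary. -/
def IsInner (m : ℕ) (e : Bond) : Prop :=
  if e.1 then |e.2.1| < m ∧ -(m : ℤ) ≤ e.2.2 ∧ e.2.2 < m
  else |e.2.2| < m ∧ -(m : ℤ) ≤ e.2.1 ∧ e.2.1 < m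

open Classical in
/-- The factor of a bond: on the horizontal axis it is `s` to the right of the segment of
length `n`, zero along the segment and `t` to the left of the segment. -/
noncomputable def axisFactor (n : ℕ) (s t : ℝ) (e : Bond) : ℝ :=
  if e.1 = false ∧ e.2.2 = 0 then
    if -1 ≤ e.2.1 then s else if -(n : ℤ) ≤ e.2.1 then 0 else t
  else 1

open Classical in
/-- The bond weights of a system in `box m` with plus boundary condition, in which the spins on a
segment of length `n` agree. -/
noncomputable def slitWeight (x : ℝ) (n m : ℕ) (s t : ℝ) (e : Bond) : ℝ :=
  if IsInner m e then x * axisFactor n s t e else 0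

lemma abs_axisFactor_le (n : ℕ) {s t : ℝ} (hs : |s| ≤ 1) (ht : |t| ≤ 1) (e : Bond) :
    |axisFactor n s t e| ≤ 1 := by
  unfold axisFactor
  split_ifs <;> simp [hs, ht]

lemma abs_slitWeight_le {x : ℝ} (hx : 0 ≤ x) (n m : ℕ) {s t : ℝ} (hs : |s| ≤ 1) (ht : |t| ≤ 1)
    (e : Bond) : |slitWeight x n m s t e| ≤ x := by
  unfold slitWeight
  split_ifs
  · rw [abs_mul, abs_of_nonneg hx]
    exact mul_le_of_le_one_right hx (abs_axisFactor_le n hs ht e)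
  · simpa using hx

lemma cut_eq_false_of_wt_ne_zero {m : ℕ} {w : Bond → ℝ} {A : Finset (ℤ × ℤ)}
    (h : wt m w (fun _ => false) A ≠ 0) {e : Bond} (he : e ∈ bonds m) (hw : w e = 0) :
    cut A e = false := by
  have := Finset.prod_ne_zero_iff.1 h e he
  by_contra hc
  simp [hc, hw] at this

lemma cut_eq_false_iff {A : Finset (ℤ × ℤ)} {e : Bond} :
    cut A e = false ↔ (e.2 ∈ A ↔ tgt e ∈ A) := by
  by_cases h1 : e.2 ∈ A <;> by_cases h2 : tgt e ∈ A <;> simp [cut, h1, h2]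

lemma subset_box_of_wt_ne_zero {N : ℕ} {w : Bond → ℝ} (hw : ∀ e, ¬ IsInner (N + 1) e → w e = 0)
    {A : Finset (ℤ × ℤ)} (hA : A ⊆ box (N + 1)) (h : wt (N + 1) w (fun _ => false) A ≠ 0) :
    A ⊆ box N := by
  have hmem : ∀ e : Bond, e.2 ∈ A → ¬ IsInner (N + 1) e → tgt e ∈ A := fun e he hi =>
    (cut_eq_false_iff.1 (cut_eq_false_of_wt_ne_zero h (mem_bonds.2 (hA he)) (hw e hi))).1 he
  rintro ⟨a, b⟩ hz
  by_contra hzb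
  have hb := hA hz
  rw [mem_box] at hb hzb
  push_cast at hb hzb
  by_cases ha : |a| ≤ N
  · have hbb : ¬ |b| < ((N + 1 : ℕ) : ℤ) := by push_cast; omega
    have key : ∀ k : ℕ, (a + k, b) ∈ A := by
      intro k
      induction k with
      | zero => simpa using hz
      | succ k ih =>
        have := hmem (false, (a + k, b)) ih (by
          simp only [IsInner, Bool.false_eq_true, if_false]; tauto)
        simpa [tgt, add_assoc] using this
    have := hA (key (2 * N + 3))
    rw [mem_box] at this
    push_cast at this
    rw [abs_le] at this hb
    omega
  · have hbb : ¬ |a| < ((N + 1 : ℕ) : ℤ) := by push_cast; omega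
    have key : ∀ k : ℕ, (a, b + k) ∈ A := by
      intro k
      induction k with
      | zero => simpa using hz
      | succ k ih =>
        have := hmem (true, (a, b + k)) ih (by
          simp only [IsInner, if_true]; tauto)
        simpa [tgt, add_assoc] using this
    have := hA (key (2 * N + 3))
    rw [mem_box] at this
    push_cast at this
    rw [abs_le, abs_le] at this hb
    omega

lemma slit_of_wt_ne_zero {n N : ℕ} (hn : n ≤ N) {w : Bond → ℝ}
    (hw : ∀ a : ℤ, -(n : ℤ) ≤ a → a < -1 → w (false, (a, 0)) = 0)
    {A : Finset (ℤ × ℤ)} (h : wt (N + 1) w (fun _ => false) A ≠ 0) {a : ℤ} (ha : -(n : ℤ) ≤ a)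
    (ha' : a ≤ -1) : (a, 0) ∈ A ↔ (-1, 0) ∈ A := by
  have key : ∀ k : ℕ, (k : ℤ) + 1 ≤ n → ((-1 - (k : ℤ), (0 : ℤ)) ∈ A ↔ (-1, 0) ∈ A) := by
    intro k hk
    induction k with
    | zero => simp
    | succ k ih =>
      push_cast at hk ⊢
      rw [← ih (by omega)]
      have h1 := cut_eq_false_iff.1 (cut_eq_false_of_wt_ne_zero h
        (e := (false, (-1 - ((k : ℤ) + 1), 0))) (mem_bonds.2 (mem_box.2 ?_))
        (hw _ (by omega) (by omega)))
      · simp only [tgt, Bool.false_eq_true, if_false] at h1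
        convert h1 using 3
        ring_nf
      · push_cast
        rw [abs_le, abs_zero]
        omega
  obtain ⟨k, hk⟩ := Int.eq_ofNat_of_zero_le (show 0 ≤ -1 - a by omega)
  have := key k (by omega)
  rwa [← hk, sub_sub_cancel] at this

lemma sum_box_shift {m : ℕ} {A : Finset (ℤ × ℤ)} (hA : A ⊆ box m) (d : ℤ × ℤ)
    (hd : ∀ z ∈ A, z - d ∈ box m) :
    ∑ z ∈ box m, (if z ∉ A ∧ z + d ∈ A then 1 else 0) =
      ∑ z ∈ box m, (if z ∈ A ∧ z - d ∉ A then 1 else 0) := by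
  rw [← Finset.sum_filter, ← Finset.sum_filter]
  refine Finset.sum_nbij' (fun z => z + d) (fun z => z - d) ?_ ?_ ?_ ?_ (fun _ _ => rfl)
  · intro z hz
    simp only [Finset.mem_filter] at hz ⊢
    exact ⟨hA hz.2.2, hz.2.2, by simpa using hz.2.1⟩
  · intro z hz
    simp only [Finset.mem_filter] at hz ⊢
    exact ⟨hd z hz.2.1, hz.2.2, by simpa using hz.2.1⟩
  · intro z _; simp
  · intro z _; simp

lemma perim_eq_card_cut {N : ℕ} {A : Finset (ℤ × ℤ)} (hA : A ⊆ box N) :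
    perim A = ((bonds (N + 1)).filter fun e => cut A e).card := by
  have hA' : A ⊆ box (N + 1) := by
    intro z hz
    have := mem_box.1 (hA hz)
    rw [mem_box]
    push_cast
    omega
  have h1 := sum_box_shift hA' (1, 0) fun z hz => by
    have := mem_box.1 (hA hz)
    rw [abs_le, abs_le] at this
    rw [mem_box, abs_le, abs_le]
    simp only [Prod.fst_sub, Prod.snd_sub]
    push_cast
    omega
  have h2 := sum_box_shift hA' (0, 1) fun z hz => by
    have := mem_box.1 (hA hz)
    rw [abs_le, abs_le] at this
    rw [mem_box, abs_le, abs_le]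
    simp only [Prod.fst_sub, Prod.snd_sub]
    push_cast
    omega
  rw [perim_eq_sum hA', Finset.card_filter, bonds, Finset.sum_product, Fintype.sum_bool,
    ← Finset.sum_add_distrib]
  have hcut : ∀ e : Bond, (if cut A e then 1 else 0) =
      (if e.2 ∈ A ∧ tgt e ∉ A then 1 else 0) + (if e.2 ∉ A ∧ tgt e ∈ A then 1 else 0) := by
    intro e
    by_cases h1 : e.2 ∈ A <;> by_cases h2 : tgt e ∈ A <;> simp [cut, h1, h2]
  simp only [hcut]
  have e1 : ∀ z : ℤ × ℤ, tgt (true, z) = z + (0, 1) := fun z => by simp [tgt, Prod.ext_iff]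
  have e2 : ∀ z : ℤ × ℤ, tgt (false, z) = z + (1, 0) := fun z => by simp [tgt, Prod.ext_iff]
  simp only [e1, e2]
  rw [Finset.sum_add_distrib, Finset.sum_add_distrib, Finset.sum_add_distrib, h1, h2]
  rw [← Finset.sum_add_distrib, ← Finset.sum_add_distrib, ← Finset.sum_add_distrib]
  refine Finset.sum_congr rfl fun z _ => ?_
  obtain ⟨a, b⟩ := z
  simp only [nbrs]
  rw [Finset.sum_insert, Finset.sum_insert, Finset.sum_insert, Finset.sum_singleton]
  · simp only [Prod.mk_add_mk, Prod.mk_sub_mk, add_zero, sub_zero]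
    ring
  all_goals simp <;> omega

lemma prod_telescope {f : ℤ → ℝ} (hf : ∀ a, f a * f a = 1) {i j : ℤ} (hij : i ≤ j) :
    ∏ a ∈ Finset.Ico i j, f a * f (a + 1) = f i * f j := by
  induction j, hij using Int.leInduction with
  | base => simp [hf]
  | succ j hj ih =>
    rw [← Finset.insert_Ico_right_eq_Ico_add_one hj, Finset.prod_insert (by simp), ih]
    linear_combination f i * f (j + 1) * hf j

/-- The product of the factors of the cut bonds along a piece of the horizontal axis. -/
lemma prod_axis_cut {A : Finset (ℤ × ℤ)} {s : ℝ} (hs : s * s = 1) {i j : ℤ} (hij : i ≤ j) :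
    ∏ a ∈ Finset.Ico i j, (if cut A (false, (a, 0)) then s else 1) =
      (if (i, (0 : ℤ)) ∈ A then s else 1) * (if (j, (0 : ℤ)) ∈ A then s else 1) := by
  rw [← prod_telescope (f := fun a => if (a, (0 : ℤ)) ∈ A then s else 1) _ hij]
  · refine Finset.prod_congr rfl fun a _ => ?_
    by_cases h1 : (a, (0 : ℤ)) ∈ A <;> by_cases h2 : (a + 1, (0 : ℤ)) ∈ A <;>
      simp [cut, tgt, h1, h2, hs]
  · intro a
    split_ifs <;> simp [hs]

lemma wt_slitWeight {x : ℝ} {n N : ℕ} (hn : 1 ≤ n) (hnN : n ≤ N) {s t : ℝ} (hs : s * s = 1)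
    (ht : t * t = 1) {A : Finset (ℤ × ℤ)} (hA : A ⊆ box N)
    (hslit : ∀ a : ℤ, -(n : ℤ) ≤ a → a ≤ -1 → ((a, (0 : ℤ)) ∈ A ↔ ((-1 : ℤ), (0 : ℤ)) ∈ A)) :
    wt (N + 1) (slitWeight x n (N + 1) s t) (fun _ => false) A =
      x ^ perim A * if ((-1 : ℤ), (0 : ℤ)) ∈ A then s * t else 1 := by
  have hinner : ∀ e : Bond, cut A e = true → IsInner (N + 1) e := by
    rintro ⟨d, a, b⟩ he
    have : (a, b) ∈ A ∨ tgt (d, a, b) ∈ A := by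
      by_contra! h
      simp [cut, h.1, h.2] at he
    have h2 := this.imp (fun h => mem_box.1 (hA h)) (fun h => mem_box.1 (hA h))
    unfold IsInner
    cases d <;> simp only [tgt, if_true, if_false, Bool.false_eq_true, abs_le, abs_lt] at h2 ⊢ <;>
      push_cast <;> omega
  have hprod : ∀ e ∈ bonds (N + 1),
      (if xor (cut A e) false then slitWeight x n (N + 1) s t e else 1) =
        (if cut A e then x else 1) * if cut A e then axisFactor n s t e else 1 := by
    intro e _
    by_cases h : cut A e
    · simp [h, slitWeight, hinner e h]
    · simp [h]
  rw [wt, Finset.prod_congr rfl hprod, Finset.prod_mul_distrib, ← Finset.prod_filter,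
    Finset.prod_const, ← perim_eq_card_cut hA]
  congr 1
  have hnot : ∀ a b : ℤ, (N : ℤ) < |a| → (a, b) ∉ A := fun a b h h' => by
    have := (mem_box.1 (hA h')).1
    dsimp only at this
    omega
  rw [bonds, Finset.prod_product, Fintype.prod_bool, Finset.prod_eq_one (fun z _ => by
    simp [axisFactor]), one_mul, box, Finset.prod_product_right]
  rw [Finset.prod_eq_single 0 (fun b _ hb => Finset.prod_eq_one fun a _ => by
    simp [axisFactor, hb]) (fun h => absurd (Finset.mem_Icc.2 (by omega)) h)]
  have hsplit : Finset.Icc (-((N + 1 : ℕ) : ℤ)) ((N + 1 : ℕ) : ℤ) =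
      Finset.Ico (-((N + 1 : ℕ) : ℤ)) (-n) ∪ (Finset.Ico (-(n : ℤ)) (-1) ∪
        Finset.Ico (-1) (((N + 1 : ℕ) : ℤ) + 1)) := by
    ext a
    simp only [Finset.mem_union, Finset.mem_Icc, Finset.mem_Ico]
    omega
  rw [hsplit, Finset.prod_union, Finset.prod_union]
  · have h1 : ∏ a ∈ Finset.Ico (-((N + 1 : ℕ) : ℤ)) (-n),
        (if cut A (false, (a, 0)) then axisFactor n s t (false, (a, 0)) else 1) =
        ∏ a ∈ Finset.Ico (-((N + 1 : ℕ) : ℤ)) (-n), if cut A (false, (a, 0)) then t else 1 := by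
      refine Finset.prod_congr rfl fun a ha => ?_
      rw [Finset.mem_Ico] at ha
      have h1 : ¬ -1 ≤ a := by omega
      have h2 : ¬ -(n : ℤ) ≤ a := by omega
      simp [axisFactor, h1, h2]
    have h2 : ∏ a ∈ Finset.Ico (-(n : ℤ)) (-1),
        (if cut A (false, (a, 0)) then axisFactor n s t (false, (a, 0)) else 1) = 1 := by
      refine Finset.prod_eq_one fun a ha => ?_
      rw [Finset.mem_Ico] at ha
      have : cut A (false, (a, 0)) = false := by
        rw [cut_eq_false_iff]
        simp only [tgt, Bool.false_eq_true, if_false]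
        rw [hslit a (by omega) (by omega), hslit (a + 1) (by omega) (by omega)]
      simp [this]
    have h3 : ∏ a ∈ Finset.Ico (-1) (((N + 1 : ℕ) : ℤ) + 1),
        (if cut A (false, (a, 0)) then axisFactor n s t (false, (a, 0)) else 1) =
        ∏ a ∈ Finset.Ico (-1) (((N + 1 : ℕ) : ℤ) + 1), if cut A (false, (a, 0)) then s else 1 := by
      refine Finset.prod_congr rfl fun a ha => ?_
      rw [Finset.mem_Ico] at ha
      simp [axisFactor, ha.1]
    rw [h1, h2, h3, prod_axis_cut ht (by omega), prod_axis_cut hs (by omega),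
      if_neg (hnot _ _ (by rw [abs_neg, Nat.abs_cast]; push_cast; omega)),
      if_neg (hnot (((N + 1 : ℕ) : ℤ) + 1) 0 (by rw [abs_of_nonneg] <;> push_cast <;> omega))]
    simp only [hslit (-n) le_rfl (by omega)]
    split_ifs <;> ring
  · rw [Finset.disjoint_left]
    intro a; simp only [Finset.mem_Ico]; omega
  · rw [Finset.disjoint_left]
    intro a; simp only [Finset.mem_union, Finset.mem_Ico]; omega

lemma mem_segment {n : ℕ} {a b : ℤ} : (a, b) ∈ segment n ↔ -(n : ℤ) ≤ a ∧ a ≤ -1 ∧ b = 0 := by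
  simp [segment, and_assoc, eq_comm]

/-- At `s, t = ±1` the partition function is a combination of contour sums. -/
lemma partFun_slitWeight (x : ℝ) {n N : ℕ} (hn : 1 ≤ n) (hnN : n ≤ N) {s t : ℝ} (hs : s * s = 1)
    (ht : t * t = 1) :
    partFun (N + 1) (slitWeight x n (N + 1) s t) =
      contourSum x ∅ (box N \ segment n) + s * t * contourSum x (segment n) (box N) := by
  have hseg : segment n ⊆ box N := by
    rintro ⟨a, b⟩ hz
    rw [mem_segment] at hz
    rw [mem_box, abs_le, abs_le]
    dsimp only
    omega
  have hm1 : ((-1 : ℤ), (0 : ℤ)) ∈ segment n := by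
    rw [mem_segment]
    omega
  have hmem : ∀ a : ℤ, -(n : ℤ) ≤ a → a ≤ -1 → (a, (0 : ℤ)) ∈ segment n := fun a h1 h2 => by
    rw [mem_segment]
    omega
  have hbox : box N ⊆ box (N + 1) := by
    intro z hz
    have := mem_box.1 hz
    rw [mem_box]
    push_cast
    omega
  have hdisj : Disjoint (Finset.Icc ∅ (box N \ segment n)) (Finset.Icc (segment n) (box N)) := by
    rw [Finset.disjoint_left]
    intro A h1 h2
    rw [Finset.mem_Icc] at h1 h2
    exact (Finset.mem_sdiff.1 (h1.2 (h2.1 hm1))).2 hm1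
  rw [contourSum, contourSum, Finset.mul_sum]
  have e1 : ∀ A ∈ Finset.Icc ∅ (box N \ segment n),
      wt (N + 1) (slitWeight x n (N + 1) s t) (fun _ => false) A = x ^ perim A := by
    intro A hA
    rw [Finset.mem_Icc] at hA
    have hn' : ∀ z ∈ segment n, z ∉ A := fun z hz h => (Finset.mem_sdiff.1 (hA.2 h)).2 hz
    rw [wt_slitWeight hn hnN hs ht (hA.2.trans Finset.sdiff_subset), if_neg (hn' _ hm1), mul_one]
    intro a h1 h2
    simp only [hn' _ hm1, hn' _ (hmem a h1 h2)]
  have e2 : ∀ A ∈ Finset.Icc (segment n) (box N),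
      wt (N + 1) (slitWeight x n (N + 1) s t) (fun _ => false) A = s * t * x ^ perim A := by
    intro A hA
    rw [Finset.mem_Icc] at hA
    rw [wt_slitWeight hn hnN hs ht hA.2, if_pos (hA.1 hm1), mul_comm]
    intro a h1 h2
    simp only [hA.1 hm1, hA.1 (hmem a h1 h2)]
  rw [← Finset.sum_congr rfl e1, ← Finset.sum_congr rfl e2, ← Finset.sum_union hdisj, partFun]
  symm
  refine Finset.sum_subset ?_ ?_
  · intro A hA
    rw [Finset.mem_powerset]
    rcases Finset.mem_union.1 hA with hA | hA
    · exact ((Finset.mem_Icc.1 hA).2.trans Finset.sdiff_subset).trans hbox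
    · exact (Finset.mem_Icc.1 hA).2.trans hbox
  · intro A hA hA'
    by_contra hwt
    rw [Finset.mem_powerset] at hA
    have hAN := subset_box_of_wt_ne_zero (fun e he => by simp [slitWeight, he]) hA hwt
    have hslit : ∀ a : ℤ, -(n : ℤ) ≤ a → a ≤ -1 → ((a, (0 : ℤ)) ∈ A ↔ ((-1 : ℤ), (0 : ℤ)) ∈ A) :=
      fun a h1 h2 => slit_of_wt_ne_zero hnN (fun a h1 h2 => by
        have h3 : ¬ -1 ≤ a := by omega
        simp [slitWeight, axisFactor, h1, h3]) hwt h1 h2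
    refine hA' (Finset.mem_union.2 ?_)
    rw [Finset.mem_Icc, Finset.mem_Icc]
    by_cases h : ((-1 : ℤ), (0 : ℤ)) ∈ A
    · refine Or.inr ⟨?_, hAN⟩
      rintro ⟨a, b⟩ hz
      rw [mem_segment] at hz
      rw [hz.2.2, hslit a hz.1 hz.2.1]
      exact h
    · refine Or.inl ⟨Finset.empty_subset _, fun z hz => Finset.mem_sdiff.2 ⟨hAN hz, fun hzs => ?_⟩⟩
      obtain ⟨a, b⟩ := z
      rw [mem_segment] at hzs
      rw [hzs.2.2, hslit a hzs.1 hzs.2.1] at hz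
      exact h hz

lemma hasDerivAt_partFun (m : ℕ) {w : ℝ → Bond → ℝ} {w' : Bond → ℝ} {s : ℝ}
    (h : ∀ e ∈ bonds m, HasDerivAt (fun s => w s e) (w' e) s) :
    HasDerivAt (fun s => partFun m (w s)) (∑ e ∈ bonds m, w' e * partFunDeriv m (w s) e) s := by
  have key : ∀ A ∈ (box m).powerset, HasDerivAt (fun s => wt m (w s) (fun _ => false) A)
      (∑ e ∈ bonds m, (∏ f ∈ (bonds m).erase e, if cut A f then w s f else 1) •
        if cut A e then w' e else 0) s := by
    intro A _
    have := HasDerivAt.fun_finsetProd (u := bonds m)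
      (f := fun e s => if cut A e then w s e else 1) (f' := fun e => if cut A e then w' e else 0)
      (x := s) (fun e he => by
        by_cases hc : cut A e
        · simpa [hc] using h e he
        · simpa [hc] using hasDerivAt_const s (1 : ℝ))
    simpa [wt] using this
  refine (HasDerivAt.fun_sum key).congr_deriv ?_
  rw [Finset.sum_comm]
  refine Finset.sum_congr rfl fun e _ => ?_
  rw [partFunDeriv, Finset.mul_sum]
  refine Finset.sum_congr rfl fun A _ => ?_
  split_ifs <;> simp [mul_comm]

lemma hasDerivAt_partFun_slitWeight (x : ℝ) {n m : ℕ} (hm : 1 ≤ m) (s t : ℝ) :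
    HasDerivAt (fun s => partFun m (slitWeight x n m s t))
      (∑ c ∈ Finset.Ico (-1 : ℤ) m, -(x / 2) *
        (obs m (slitWeight x n m s t) c (c, 0) (c, 0) +
          obs m (slitWeight x n m s t) c (c, 0) (c + 1, 0))) s := by
  have h := hasDerivAt_partFun m (w := fun s => slitWeight x n m s t)
    (w' := fun e => if e ∈ (Finset.Ico (-1 : ℤ) m).image (fun c => ((false, (c, 0)) : Bond))
      then x else 0) (s := s) ?_
  · convert h using 1
    simp only [ite_mul, zero_mul]
    rw [← Finset.sum_filter, Finset.filter_mem_eq_inter, Finset.inter_eq_right.2,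
      Finset.sum_image (by simp [Set.InjOn])]
    · refine Finset.sum_congr rfl fun c hc => ?_
      rw [Finset.mem_Ico] at hc
      rw [obs_source]
      · ring
      · rw [mem_box, abs_le, abs_le]
        dsimp only
        omega
    · intro e he
      obtain ⟨c, hc, rfl⟩ := Finset.mem_image.1 he
      rw [Finset.mem_Ico] at hc
      rw [mem_bonds, mem_box, abs_le, abs_le]
      dsimp only
      omega
  · rintro ⟨d, a, b⟩ _
    have hmem : (d, (a, b)) ∈ (Finset.Ico (-1 : ℤ) m).image (fun c => ((false, (c, 0)) : Bond)) ↔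
        d = false ∧ b = 0 ∧ -1 ≤ a ∧ a < m := by
      simp only [Finset.mem_image, Finset.mem_Ico, Prod.mk.injEq]
      constructor
      · rintro ⟨c, h, rfl, rfl, rfl⟩; exact ⟨rfl, rfl, h⟩
      · rintro ⟨rfl, rfl, h⟩; exact ⟨a, h, rfl, rfl, rfl⟩
    by_cases hR : d = false ∧ b = 0 ∧ -1 ≤ a ∧ a < m
    · rw [if_pos (hmem.2 hR)]
      obtain ⟨rfl, rfl, h1, h2⟩ := hR
      have hi : IsInner m (false, (a, 0)) := by
        simp only [IsInner, Bool.false_eq_true, if_false, abs_zero]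
        omega
      simpa [slitWeight, hi, axisFactor, h1] using (hasDerivAt_id s).const_mul x
    · rw [if_neg (fun h => hR (hmem.1 h))]
      have : (fun s => slitWeight x n m s t (d, a, b)) =
          fun _ => slitWeight x n m 0 t (d, a, b) := by
        funext s
        unfold slitWeight
        split_ifs with hi
        · unfold axisFactor
          split_ifs with h1 h2
          · exfalso
            dsimp only at h1 h2
            simp only [IsInner, h1.1, Bool.false_eq_true, if_false] at hi
            exact hR ⟨h1.1, h1.2, h2, hi.2.2⟩
          · rfl
          · rfl
          · rfl
        · rfl
      rw [this]
      exact hasDerivAt_const _ _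

/-- The faces of the square `box m`, given by their lower left corners. -/
noncomputable def faces (m : ℕ) : Finset (ℤ × ℤ) :=
  Finset.Ico (-(m : ℤ)) m ×ˢ Finset.Ico (-(m : ℤ)) m

lemma mem_faces {m : ℕ} {a b : ℤ} :
    (a, b) ∈ faces m ↔ (-(m : ℤ) ≤ a ∧ a < m) ∧ (-(m : ℤ) ≤ b ∧ b < m) := by
  simp [faces]

section Faces

variable (X : ℤ × ℤ → ℤ × ℤ → ℝ) (v : ℤ × ℤ)

/-- The sum of `X` over the two corners of the face `v` on its bottom side. -/
def botSum : ℝ := X v v + X v (v.1 + 1, v.2)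

/-- The difference of `X` along the bottom side of the face `v`. -/
def botDiff : ℝ := X v v - X v (v.1 + 1, v.2)

/-- The sum of `X` over the two corners of the face `v` on its top side. -/
def topSum : ℝ := X v (v.1, v.2 + 1) + X v (v.1 + 1, v.2 + 1)

/-- The difference of `X` along the top side of the face `v`. -/
def topDiff : ℝ := X v (v.1, v.2 + 1) - X v (v.1 + 1, v.2 + 1)

/-- The sum of `X` over the two corners of the face `v` on its left side. -/
def leftSum : ℝ := X v v + X v (v.1, v.2 + 1)

/-- The difference of `X` along the left side of the face `v`. -/
def leftDiff : ℝ := X v v - X v (v.1, v.2 + 1)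

/-- The sum of `X` over the two corners of the face `v` on its right side. -/
def rightSum : ℝ := X v (v.1 + 1, v.2) + X v (v.1 + 1, v.2 + 1)

/-- The difference of `X` along the right side of the face `v`. -/
def rightDiff : ℝ := X v (v.1 + 1, v.2) - X v (v.1 + 1, v.2 + 1)

/-- The energy coming into the face `v`. -/
def inEnergy : ℝ := botDiff X v ^ 2 + topDiff X v ^ 2 + leftSum X v ^ 2 + rightDiff X v ^ 2

/-- The energy going out of the face `v`. -/
def outEnergy : ℝ := botSum X v ^ 2 + topSum X v ^ 2 + leftDiff X v ^ 2 + rightSum X v ^ 2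

lemma inEnergy_nonneg : 0 ≤ inEnergy X v := by unfold inEnergy; positivity

lemma outEnergy_le : outEnergy X v ≤ (1 + √2) ^ 2 * inEnergy X v := by
  simp only [outEnergy, inEnergy, botSum, topSum, leftSum, rightSum, botDiff, topDiff, leftDiff,
    rightDiff]
  have h2 : √2 ^ 2 = 2 := Real.sq_sqrt (by norm_num)
  have h0 : 0 ≤ √2 := Real.sqrt_nonneg 2
  generalize √2 = r at *
  generalize X v v = a
  generalize X v (v.1 + 1, v.2) = b
  generalize X v (v.1, v.2 + 1) = c
  generalize X v (v.1 + 1, v.2 + 1) = d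
  have key : 0 ≤ (4 + 4 * r) * ((a - r / 2 * (b - c)) ^ 2 + (d - r / 2 * (b + c)) ^ 2) := by
    positivity
  linear_combination key - ((a - b) ^ 2 + (c - d) ^ 2 + (a + c) ^ 2 + (b - d) ^ 2 +
    4 * (a * (b - c) + d * (b + c)) - (2 + 2 * r) * (b ^ 2 + c ^ 2)) * h2

end Faces

/-- The linear relations between the incoming and outgoing values at the faces of `box m`, with
sources at the bottom and at the top of the faces. -/
structure IsSolution (m : ℕ) (w : Bond → ℝ) (X : ℤ × ℤ → ℤ × ℤ → ℝ) (S T : ℤ × ℤ → ℝ) :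
    Prop where
  left : ∀ v ∈ faces m, leftSum X v = w (true, v) * rightSum X (v.1 - 1, v.2)
  right : ∀ v ∈ faces m, rightDiff X v = w (true, (v.1 + 1, v.2)) * leftDiff X (v.1 + 1, v.2)
  bot : ∀ v ∈ faces m, botDiff X v = -w (false, v) * topSum X (v.1, v.2 - 1) + S v
  top : ∀ v ∈ faces m, topDiff X v =
    -w (false, (v.1, v.2 + 1)) * botSum X (v.1, v.2 + 1) + T v

/-- Bond weights bounded by `x` which vanish on the boundary of `box m`. -/
structure WeightBound (m : ℕ) (x : ℝ) (w : Bond → ℝ) : Prop where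
  abs_le : ∀ e, |w e| ≤ x
  eq_zero : ∀ e, ¬ IsInner m e → w e = 0

lemma WeightBound.nonneg {m : ℕ} {x : ℝ} {w : Bond → ℝ} (h : WeightBound m x w) : 0 ≤ x :=
  (abs_nonneg _).trans (h.abs_le (true, 0))

lemma WeightBound.sq_le {m : ℕ} {x : ℝ} {w : Bond → ℝ} (h : WeightBound m x w) (e : Bond) :
    w e ^ 2 ≤ x ^ 2 := sq_le_sq' (_root_.abs_le.1 (h.abs_le e)).1 (_root_.abs_le.1 (h.abs_le e)).2

lemma isSolution_obs {m : ℕ} (w : Bond → ℝ) {c : ℤ} (hc : (c, 0) ∈ box m) :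
    IsSolution m w (obs m w c)
      (fun v => if v.1 = c ∧ v.2 = 0 then -(2 * w (false, v) * partFun m w) else 0)
      (fun v => if v.1 = c ∧ v.2 + 1 = 0 then -(2 * partFun m w) else 0) := by
  constructor
  · rintro ⟨a, b⟩ hv
    rw [mem_faces] at hv
    have := obs_vertical_right w c (a := a) (b := b) (m := m) (mem_box.2 (by
      dsimp only; rw [abs_le, abs_le]; omega))
    simpa [leftSum, rightSum] using this
  · rintro ⟨a, b⟩ hv
    rw [mem_faces] at hv
    have := obs_vertical_left w c (a := a + 1) (b := b) (m := m) (mem_box.2 (by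
      dsimp only; rw [abs_le, abs_le]; omega))
    simpa [leftDiff, rightDiff] using this
  · rintro ⟨a, b⟩ hv
    rw [mem_faces] at hv
    have := obs_horizontal_above w hc (a := a) (b := b) (m := m) (mem_box.2 (by
      dsimp only; rw [abs_le, abs_le]; omega))
    simp only [botDiff, topSum, sub_add_cancel, this]
    split_ifs <;> ring
  · rintro ⟨a, b⟩ hv
    rw [mem_faces] at hv
    have := obs_horizontal_below w hc (a := a) (b := b + 1) (m := m) (mem_box.2 (by
      dsimp only; rw [abs_le, abs_le]; omega))
    rw [add_sub_cancel_right] at this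
    simp only [topDiff, botSum, this]
    split_ifs <;> ring

lemma sum_le_sum_of_shift {ι : Type*} [DecidableEq ι] {F : Finset ι} {s : ι → ι}
    (hs : Function.Injective s) {g h : ι → ℝ} (hh : ∀ v, 0 ≤ h v)
    (hgh : ∀ v ∈ F, g v ≤ 0 ∨ s v ∈ F ∧ g v ≤ h (s v)) : ∑ v ∈ F, g v ≤ ∑ v ∈ F, h v := by
  calc ∑ v ∈ F, g v ≤ ∑ v ∈ F, if s v ∈ F then h (s v) else 0 := by
        refine Finset.sum_le_sum fun v hv => ?_
        rcases hgh v hv with h1 | h1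
        · split_ifs
          · exact h1.trans (hh _)
          · exact h1
        · rw [if_pos h1.1]
          exact h1.2
    _ = ∑ v ∈ (F.filter fun v => s v ∈ F).image s, h v := by
        rw [← Finset.sum_filter, Finset.sum_image fun _ _ _ _ h => hs h]
    _ ≤ ∑ v ∈ F, h v := by
        refine Finset.sum_le_sum_of_subset_of_nonneg ?_ fun v _ _ => hh v
        intro v hv
        obtain ⟨u, hu, rfl⟩ := Finset.mem_image.1 hv
        exact (Finset.mem_filter.1 hu).2

lemma sq_add_le {q : ℝ} (hq : 1 < q) (a b : ℝ) :
    (a + b) ^ 2 ≤ q * a ^ 2 + q / (q - 1) * b ^ 2 := by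
  have h : 0 < q - 1 := by linarith
  have : q * a ^ 2 + q / (q - 1) * b ^ 2 - (a + b) ^ 2 = ((q - 1) * a - b) ^ 2 / (q - 1) := by
    field_simp
    ring
  have h2 : 0 ≤ ((q - 1) * a - b) ^ 2 / (q - 1) := by positivity
  linarith

/-- A weight depending on the column, of moderate variation. -/
structure SlowWeight (q : ℝ) (φ : ℤ → ℝ) : Prop where
  nonneg : ∀ a, 0 ≤ φ a
  le_succ : ∀ a, φ a ≤ q * φ (a + 1)
  le_pred : ∀ a, φ a ≤ q * φ (a - 1)

lemma energy_le {m : ℕ} {w : Bond → ℝ} {X : ℤ × ℤ → ℤ × ℤ → ℝ} {S T : ℤ × ℤ → ℝ} {x q : ℝ}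
    {φ : ℤ → ℝ} (hX : IsSolution m w X S T) (hw : WeightBound m x w) (hq : 1 < q)
    (hφ : SlowWeight q φ) :
    (1 - q ^ 2 * x ^ 2 * (1 + √2) ^ 2) * ∑ v ∈ faces m, φ v.1 * inEnergy X v ≤
      q / (q - 1) * ∑ v ∈ faces m, φ v.1 * (S v ^ 2 + T v ^ 2) := by
  have hq0 : 0 ≤ q := by linarith
  have hbot : ∑ v ∈ faces m, φ v.1 * (w (false, v) * topSum X (v.1, v.2 - 1)) ^ 2 ≤
      ∑ v ∈ faces m, q * x ^ 2 * (φ v.1 * topSum X v ^ 2) := by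
    refine sum_le_sum_of_shift (s := fun v => (v.1, v.2 - 1)) ?_ ?_ ?_
    · rintro ⟨a, b⟩ ⟨a', b'⟩ h
      simpa using h
    · intro v
      have := hφ.nonneg v.1
      positivity
    · rintro ⟨a, b⟩ hv
      by_cases hi : IsInner m (false, (a, b))
      · refine Or.inr ⟨?_, ?_⟩
        · rw [mem_faces] at hv ⊢
          simp only [IsInner, Bool.false_eq_true, if_false, abs_lt] at hi
          omega
        · have h1 := hw.sq_le (false, (a, b))
          have h2 := hφ.nonneg a
          calc φ a * (w (false, (a, b)) * topSum X (a, b - 1)) ^ 2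
              = w (false, (a, b)) ^ 2 * (φ a * topSum X (a, b - 1) ^ 2) := by ring
            _ ≤ (q * x ^ 2) * (φ a * topSum X (a, b - 1) ^ 2) := by
              gcongr
              exact h1.trans (le_mul_of_one_le_left (sq_nonneg x) hq.le)
      · simp [hw.eq_zero _ hi]
  have htop : ∑ v ∈ faces m, φ v.1 * (w (false, (v.1, v.2 + 1)) * botSum X (v.1, v.2 + 1)) ^ 2 ≤
      ∑ v ∈ faces m, q * x ^ 2 * (φ v.1 * botSum X v ^ 2) := by
    refine sum_le_sum_of_shift (s := fun v => (v.1, v.2 + 1)) ?_ ?_ ?_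
    · rintro ⟨a, b⟩ ⟨a', b'⟩ h
      simpa using h
    · intro v
      have := hφ.nonneg v.1
      positivity
    · rintro ⟨a, b⟩ hv
      by_cases hi : IsInner m (false, (a, b + 1))
      · refine Or.inr ⟨?_, ?_⟩
        · rw [mem_faces] at hv ⊢
          simp only [IsInner, Bool.false_eq_true, if_false, abs_lt] at hi
          omega
        · have h1 := hw.sq_le (false, (a, b + 1))
          have h2 := hφ.nonneg a
          calc φ a * (w (false, (a, b + 1)) * botSum X (a, b + 1)) ^ 2
              = w (false, (a, b + 1)) ^ 2 * (φ a * botSum X (a, b + 1) ^ 2) := by ring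
            _ ≤ (q * x ^ 2) * (φ a * botSum X (a, b + 1) ^ 2) := by
              gcongr
              exact h1.trans (le_mul_of_one_le_left (sq_nonneg x) hq.le)
      · simp [hw.eq_zero _ hi]
  have hleft : ∑ v ∈ faces m, φ v.1 * (w (true, v) * rightSum X (v.1 - 1, v.2)) ^ 2 ≤
      ∑ v ∈ faces m, q * x ^ 2 * (φ v.1 * rightSum X v ^ 2) := by
    refine sum_le_sum_of_shift (s := fun v => (v.1 - 1, v.2)) ?_ ?_ ?_
    · rintro ⟨a, b⟩ ⟨a', b'⟩ h
      simpa using h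
    · intro v
      have := hφ.nonneg v.1
      positivity
    · rintro ⟨a, b⟩ hv
      by_cases hi : IsInner m (true, (a, b))
      · refine Or.inr ⟨?_, ?_⟩
        · rw [mem_faces] at hv ⊢
          simp only [IsInner, if_true, abs_lt] at hi
          omega
        · have h1 := hw.sq_le (true, (a, b))
          have h2 := hφ.nonneg a
          calc φ a * (w (true, (a, b)) * rightSum X (a - 1, b)) ^ 2
              = w (true, (a, b)) ^ 2 * (φ a * rightSum X (a - 1, b) ^ 2) := by ring
            _ ≤ x ^ 2 * (q * φ (a - 1) * rightSum X (a - 1, b) ^ 2) := by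
              gcongr
              exact hφ.le_pred a
            _ = q * x ^ 2 * (φ (a - 1) * rightSum X (a - 1, b) ^ 2) := by ring
      · simp [hw.eq_zero _ hi]
  have hright : ∑ v ∈ faces m, φ v.1 * (w (true, (v.1 + 1, v.2)) * leftDiff X (v.1 + 1, v.2)) ^ 2 ≤
      ∑ v ∈ faces m, q * x ^ 2 * (φ v.1 * leftDiff X v ^ 2) := by
    refine sum_le_sum_of_shift (s := fun v => (v.1 + 1, v.2)) ?_ ?_ ?_
    · rintro ⟨a, b⟩ ⟨a', b'⟩ h
      simpa using h
    · intro v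
      have := hφ.nonneg v.1
      positivity
    · rintro ⟨a, b⟩ hv
      by_cases hi : IsInner m (true, (a + 1, b))
      · refine Or.inr ⟨?_, ?_⟩
        · rw [mem_faces] at hv ⊢
          simp only [IsInner, if_true, abs_lt] at hi
          omega
        · have h1 := hw.sq_le (true, (a + 1, b))
          have h2 := hφ.nonneg a
          calc φ a * (w (true, (a + 1, b)) * leftDiff X (a + 1, b)) ^ 2
              = w (true, (a + 1, b)) ^ 2 * (φ a * leftDiff X (a + 1, b) ^ 2) := by ring
            _ ≤ x ^ 2 * (q * φ (a + 1) * leftDiff X (a + 1, b) ^ 2) := by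
              gcongr
              exact hφ.le_succ a
            _ = q * x ^ 2 * (φ (a + 1) * leftDiff X (a + 1, b) ^ 2) := by ring
      · simp [hw.eq_zero _ hi]
  have hpt : ∀ v ∈ faces m, φ v.1 * inEnergy X v ≤
      q * (φ v.1 * (w (false, v) * topSum X (v.1, v.2 - 1)) ^ 2 +
        φ v.1 * (w (false, (v.1, v.2 + 1)) * botSum X (v.1, v.2 + 1)) ^ 2 +
        φ v.1 * (w (true, v) * rightSum X (v.1 - 1, v.2)) ^ 2 +
        φ v.1 * (w (true, (v.1 + 1, v.2)) * leftDiff X (v.1 + 1, v.2)) ^ 2) +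
      q / (q - 1) * (φ v.1 * (S v ^ 2 + T v ^ 2)) := by
    intro v hv
    have h0 := hφ.nonneg v.1
    have h1 := sq_add_le hq (-w (false, v) * topSum X (v.1, v.2 - 1)) (S v)
    have h2 := sq_add_le hq (-w (false, (v.1, v.2 + 1)) * botSum X (v.1, v.2 + 1)) (T v)
    have h3 := le_mul_of_one_le_left (sq_nonneg (w (true, v) * rightSum X (v.1 - 1, v.2))) hq.le
    have h4 := le_mul_of_one_le_left
      (sq_nonneg (w (true, (v.1 + 1, v.2)) * leftDiff X (v.1 + 1, v.2))) hq.le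
    rw [inEnergy, hX.left v hv, hX.right v hv, hX.bot v hv, hX.top v hv]
    refine (mul_le_mul_of_nonneg_left (add_le_add (add_le_add (add_le_add h1 h2) h3) h4)
      h0).trans_eq ?_
    ring
  have hsum := Finset.sum_le_sum hpt
  simp only [Finset.sum_add_distrib, ← Finset.mul_sum] at hsum hbot htop hleft hright
  have hout : ∑ v ∈ faces m, φ v.1 * topSum X v ^ 2 + ∑ v ∈ faces m, φ v.1 * botSum X v ^ 2 +
      ∑ v ∈ faces m, φ v.1 * rightSum X v ^ 2 + ∑ v ∈ faces m, φ v.1 * leftDiff X v ^ 2 ≤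
      (1 + √2) ^ 2 * ∑ v ∈ faces m, φ v.1 * inEnergy X v := by
    rw [← Finset.sum_add_distrib, ← Finset.sum_add_distrib, ← Finset.sum_add_distrib,
      Finset.mul_sum]
    refine Finset.sum_le_sum fun v _ => ?_
    have := mul_le_mul_of_nonneg_left (outEnergy_le X v) (hφ.nonneg v.1)
    rw [outEnergy] at this
    linarith
  have h5 := add_le_add (add_le_add (add_le_add hbot htop) hleft) hright
  have h6 := mul_le_mul_of_nonneg_left h5 hq0
  have h7 := mul_le_mul_of_nonneg_left hout (by positivity : 0 ≤ q * (q * x ^ 2))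
  linarith

lemma slowWeight_zpow {q : ℝ} (hq : 1 < q) {f : ℤ → ℤ} (h1 : ∀ a, f a ≤ 1 + f (a + 1))
    (h2 : ∀ a, f a ≤ 1 + f (a - 1)) : SlowWeight q fun a => q ^ f a := by
  have hq0 : 0 < q := by linarith
  refine ⟨fun a => (zpow_pos hq0 _).le, fun a => ?_, fun a => ?_⟩
  · rw [← zpow_one_add₀ hq0.ne']
    exact zpow_le_zpow_right₀ hq.le (h1 a)
  · rw [← zpow_one_add₀ hq0.ne']
    exact zpow_le_zpow_right₀ hq.le (h2 a)

/-- The constant in the energy estimate. -/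
noncomputable def energyConst (x q : ℝ) : ℝ :=
  q / (q - 1) / (1 - q ^ 2 * x ^ 2 * (1 + √2) ^ 2)

lemma energyConst_nonneg {x q : ℝ} (hq : 1 < q) (hqx : q ^ 2 * x ^ 2 * (1 + √2) ^ 2 < 1) :
    0 ≤ energyConst x q :=
  div_nonneg (div_nonneg (by linarith) (by linarith)) (by linarith)

lemma energy_le_energyConst {m : ℕ} {w : Bond → ℝ} {X : ℤ × ℤ → ℤ × ℤ → ℝ} {S T : ℤ × ℤ → ℝ}
    {x q : ℝ} {φ : ℤ → ℝ} (hX : IsSolution m w X S T) (hw : WeightBound m x w) (hq : 1 < q)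
    (hqx : q ^ 2 * x ^ 2 * (1 + √2) ^ 2 < 1) (hφ : SlowWeight q φ) :
    ∑ v ∈ faces m, φ v.1 * inEnergy X v ≤
      energyConst x q * ∑ v ∈ faces m, φ v.1 * (S v ^ 2 + T v ^ 2) := by
  rw [energyConst, div_mul_eq_mul_div, le_div_iff₀ (by linarith), mul_comm]
  exact energy_le hX hw hq hφ

lemma obs_energy_le {m : ℕ} {w : Bond → ℝ} {c : ℤ} {x q : ℝ} (hc : (c, 0) ∈ box m)
    (hw : WeightBound m x w) (hx : x ≤ 1) (hq : 1 < q)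
    (hqx : q ^ 2 * x ^ 2 * (1 + √2) ^ 2 < 1) :
    ∑ v ∈ faces m, q ^ |v.1 - c| * inEnergy (obs m w c) v ≤
      energyConst x q * (8 * partFun m w ^ 2) := by
  have hφ : SlowWeight q fun a => q ^ |a - c| := slowWeight_zpow hq
    (fun a => by cases abs_cases (a - c) <;> cases abs_cases (a + 1 - c) <;> omega)
    (fun a => by cases abs_cases (a - c) <;> cases abs_cases (a - 1 - c) <;> omega)
  refine (energy_le_energyConst (isSolution_obs w hc) hw hq hqx hφ).trans
    (mul_le_mul_of_nonneg_left ?_ (energyConst_nonneg hq hqx))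
  have h1 : ∀ v : ℤ × ℤ, q ^ |v.1 - c| *
      ((if v.1 = c ∧ v.2 = 0 then -(2 * w (false, v) * partFun m w) else 0) ^ 2 +
        (if v.1 = c ∧ v.2 + 1 = 0 then -(2 * partFun m w) else 0) ^ 2) ≤
      (if v = (c, 0) then 4 * partFun m w ^ 2 else 0) +
        if v = (c, -1) then 4 * partFun m w ^ 2 else 0 := by
    rintro ⟨a, b⟩
    have hw1 : w (false, (a, b)) ^ 2 ≤ 1 :=
      (hw.sq_le _).trans (pow_le_one₀ hw.nonneg hx)
    by_cases ha : a = c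
    · subst ha
      by_cases hb : b = 0
      · subst hb
        simp only [sub_self, abs_zero, zpow_zero, and_self, if_true, zero_add, one_ne_zero,
          and_false, if_false, Prod.mk.injEq, zero_eq_neg]
        nlinarith [mul_le_mul_of_nonneg_right hw1 (sq_nonneg (partFun m w))]
      · have : b + 1 = 0 ↔ b = -1 := by omega
        by_cases hb' : b = -1 <;> simp [hb, hb', this]
        nlinarith
    · simp [ha]
  refine (Finset.sum_le_sum fun v _ => h1 v).trans ?_
  rw [Finset.sum_add_distrib, Finset.sum_ite_eq', Finset.sum_ite_eq']
  have := sq_nonneg (partFun m w)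
  split_ifs <;> linarith

lemma botSum_sq_le (X : ℤ × ℤ → ℤ × ℤ → ℝ) (v : ℤ × ℤ) :
    botSum X v ^ 2 ≤ (1 + √2) ^ 2 * inEnergy X v := by
  refine le_trans ?_ (outEnergy_le X v)
  have := sq_nonneg (topSum X v)
  have := sq_nonneg (leftDiff X v)
  have := sq_nonneg (rightSum X v)
  rw [outEnergy]
  linarith

lemma botSum_sq_le_sum (X : ℤ × ℤ → ℤ × ℤ → ℝ) {m : ℕ} {φ : ℤ → ℝ} (hφ : ∀ a, 0 ≤ φ a) {c : ℤ}
    (hφc : φ c = 1) (hc : (c, 0) ∈ faces m) :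
    botSum X (c, 0) ^ 2 ≤ (1 + √2) ^ 2 * ∑ v ∈ faces m, φ v.1 * inEnergy X v := by
  refine (botSum_sq_le X _).trans (mul_le_mul_of_nonneg_left ?_ (sq_nonneg _))
  have := Finset.single_le_sum (f := fun v => φ v.1 * inEnergy X v)
    (fun v _ => mul_nonneg (hφ v.1) (inEnergy_nonneg X v)) hc
  simpa [hφc] using this

lemma obs_botSum_sq_le {m : ℕ} {w : Bond → ℝ} {c : ℤ} {x q : ℝ} (hc : (c, 0) ∈ faces m)
    (hw : WeightBound m x w) (hx : x ≤ 1) (hq : 1 < q)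
    (hqx : q ^ 2 * x ^ 2 * (1 + √2) ^ 2 < 1) :
    botSum (obs m w c) (c, 0) ^ 2 ≤
      (1 + √2) ^ 2 * (energyConst x q * (8 * partFun m w ^ 2)) := by
  have hq0 : 0 < q := by linarith
  have hc' : (c, 0) ∈ box m := by
    rw [mem_faces] at hc
    rw [mem_box, abs_le, abs_le]
    dsimp only
    omega
  refine (botSum_sq_le_sum _ (φ := fun a => q ^ |a - c|) (fun a => (zpow_pos hq0 _).le) (by simp)
    hc).trans (mul_le_mul_of_nonneg_left (obs_energy_le hc' hw hx hq hqx) (sq_nonneg _))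

/-- The difference of the normalised observables of two systems of bond weights. -/
noncomputable def obsSub (m : ℕ) (w w' : Bond → ℝ) (c : ℤ) (v p : ℤ × ℤ) : ℝ :=
  obs m w c v p / partFun m w - obs m w' c v p / partFun m w'

lemma isSolution_obsSub {m : ℕ} {w w' : Bond → ℝ} {c : ℤ} (hc : (c, 0) ∈ box m)
    (hv : ∀ v, w (true, v) = w' (true, v)) (hwc : w (false, (c, 0)) = w' (false, (c, 0)))
    (hZ : partFun m w ≠ 0) (hZ' : partFun m w' ≠ 0) :
    IsSolution m w (obsSub m w w' c)
      (fun v => (w' (false, v) - w (false, v)) *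
        (topSum (obs m w' c) (v.1, v.2 - 1) / partFun m w'))
      (fun v => (w' (false, (v.1, v.2 + 1)) - w (false, (v.1, v.2 + 1))) *
        (botSum (obs m w' c) (v.1, v.2 + 1) / partFun m w')) := by
  have h := isSolution_obs w hc
  have h' := isSolution_obs w' hc
  constructor
  · intro v hvF
    have e1 := h.left v hvF
    have e2 := h'.left v hvF
    rw [← hv] at e2
    simp only [leftSum, rightSum, obsSub] at *
    linear_combination e1 / partFun m w - e2 / partFun m w'
  · intro v hvF
    have e1 := h.right v hvF
    have e2 := h'.right v hvF
    rw [← hv] at e2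
    simp only [leftDiff, rightDiff, obsSub] at *
    linear_combination e1 / partFun m w - e2 / partFun m w'
  · intro v hvF
    have e1 := h.bot v hvF
    have e2 := h'.bot v hvF
    have e3 : (if v.1 = c ∧ v.2 = 0 then -(2 * w (false, v) * partFun m w) else 0) / partFun m w =
        (if v.1 = c ∧ v.2 = 0 then -(2 * w' (false, v) * partFun m w') else 0) /
          partFun m w' := by
      split_ifs with hvc
      · have : v = (c, 0) := Prod.ext hvc.1 hvc.2
        rw [this, hwc]
        field_simp
      · simp
    simp only [botDiff, topSum, obsSub] at *
    linear_combination e1 / partFun m w - e2 / partFun m w' + e3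
  · intro v hvF
    have e1 := h.top v hvF
    have e2 := h'.top v hvF
    have e3 : (if v.1 = c ∧ v.2 + 1 = 0 then -(2 * partFun m w) else 0) / partFun m w =
        (if v.1 = c ∧ v.2 + 1 = 0 then -(2 * partFun m w') else 0) / partFun m w' := by
      split_ifs with hvc
      · field_simp
      · simp
    simp only [topDiff, botSum, obsSub] at *
    linear_combination e1 / partFun m w - e2 / partFun m w' + e3

lemma sum_source_le {m n : ℕ} {c : ℤ} {q : ℝ} (hq : 1 < q) (hcn : -(n : ℤ) ≤ c) (j : ℤ)
    {D : ℤ × ℤ → ℝ} (hD : ∀ v, D v ^ 2 ≤ 4)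
    (hD0 : ∀ v ∈ faces m, D v = 0 ∨ v.1 < -(n : ℤ) ∧ (v.1, v.2 + j) ∈ faces m)
    (P : ℤ × ℤ → ℝ) (z : ℝ) :
    ∑ v ∈ faces m, q ^ (-|v.1 - c|) * (D v * (P (v.1, v.2 + j) / z)) ^ 2 ≤
      4 * (q ^ (-(n + 1 + c))) ^ 2 / z ^ 2 * ∑ v ∈ faces m, q ^ |v.1 - c| * P v ^ 2 := by
  have hq0 : 0 < q := by linarith
  rw [Finset.mul_sum]
  refine sum_le_sum_of_shift (s := fun v => (v.1, v.2 + j)) ?_ ?_ ?_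
  · rintro ⟨a, b⟩ ⟨a', b'⟩ h
    simpa using h
  · intro v
    positivity
  · intro v hv
    rcases hD0 v hv with h | ⟨h, hF⟩
    · simp [h]
    · refine Or.inr ⟨hF, ?_⟩
      have hφ : q ^ (-|v.1 - c|) ≤ (q ^ (-(n + 1 + c))) ^ 2 * q ^ |v.1 - c| := by
        rw [← zpow_natCast, ← zpow_mul, ← zpow_add₀ hq0.ne']
        refine zpow_le_zpow_right₀ hq.le ?_
        rw [abs_of_nonpos (by omega)]
        push_cast
        omega
      calc q ^ (-|v.1 - c|) * (D v * (P (v.1, v.2 + j) / z)) ^ 2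
          = q ^ (-|v.1 - c|) * (D v ^ 2 * (P (v.1, v.2 + j) / z) ^ 2) := by ring
        _ ≤ ((q ^ (-(n + 1 + c))) ^ 2 * q ^ |v.1 - c|) * (4 * (P (v.1, v.2 + j) / z) ^ 2) := by
          gcongr
          exact hD v
        _ = _ := by ring

lemma obsSub_botSum_sq_le {m n : ℕ} {w w' : Bond → ℝ} {c : ℤ} {x q : ℝ} (hc : (c, 0) ∈ faces m)
    (hcn : -(n : ℤ) ≤ c) (hw : WeightBound m x w) (hw' : WeightBound m x w') (hx : x ≤ 1)
    (hq : 1 < q) (hqx : q ^ 2 * x ^ 2 * (1 + √2) ^ 2 < 1)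
    (hww : ∀ e : Bond, ¬ (e.1 = false ∧ e.2.2 = 0 ∧ e.2.1 < -(n : ℤ)) → w e = w' e)
    (hZ : partFun m w ≠ 0) (hZ' : partFun m w' ≠ 0) :
    botSum (obsSub m w w' c) (c, 0) ^ 2 ≤
      32 * ((1 + √2) ^ 2 * energyConst x q) ^ 2 * (q ^ (-(n + 1 + c))) ^ 2 := by
  have hq0 : 0 < q := by linarith
  have hm := hc
  rw [mem_faces] at hm
  have hc' : (c, 0) ∈ box m := by
    rw [mem_box, abs_le, abs_le]
    dsimp only
    omega
  have hφ : SlowWeight q fun a => q ^ (-|a - c|) := slowWeight_zpow hq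
    (fun a => by cases abs_cases (a - c) <;> cases abs_cases (a + 1 - c) <;> omega)
    (fun a => by cases abs_cases (a - c) <;> cases abs_cases (a - 1 - c) <;> omega)
  have hsol := isSolution_obsSub hc' (fun v => hww _ (by simp)) (hww _ (by simp; omega)) hZ hZ'
  have hE := energy_le_energyConst hsol hw hq hqx hφ
  have hB := botSum_sq_le_sum (obsSub m w w' c) hφ.nonneg (c := c) (by simp) hc
  have hO := obs_energy_le hc' hw' hx hq hqx
  have hC := energyConst_nonneg hq hqx
  set Z := partFun m w'
  set Y := obs m w' c
  set C := energyConst x q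
  set k := (1 + √2) ^ 2
  set ρ := q ^ (-(n + 1 + c) : ℤ)
  have hk : 0 ≤ k := sq_nonneg _
  have hdiff : ∀ e, (w' e - w e) ^ 2 ≤ 4 := by
    intro e
    have h1 := abs_le.1 (hw.abs_le e)
    have h2 := abs_le.1 (hw'.abs_le e)
    nlinarith
  have hS := sum_source_le (m := m) hq hcn (-1) (fun v => hdiff (false, v)) (fun v hv => ?_)
    (topSum Y) Z
  have hT := sum_source_le (m := m) hq hcn 1 (fun v => hdiff (false, (v.1, v.2 + 1)))
    (fun v hv => ?_) (botSum Y) Z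
  rotate_left
  · by_cases h : v.2 + 1 = 0 ∧ v.1 < -(n : ℤ)
    · refine Or.inr ⟨h.2, ?_⟩
      obtain ⟨a, b⟩ := v
      rw [mem_faces] at hv ⊢
      dsimp only at h
      omega
    · exact Or.inl (by rw [hww (false, (v.1, v.2 + 1)) (fun hh => h hh.2), sub_self])
  · by_cases h : v.2 = 0 ∧ v.1 < -(n : ℤ)
    · refine Or.inr ⟨h.2, ?_⟩
      obtain ⟨a, b⟩ := v
      rw [mem_faces] at hv ⊢
      dsimp only at h
      omega
    · exact Or.inl (by rw [hww (false, v) (fun hh => h hh.2), sub_self])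
  simp only [← sub_eq_add_neg] at hS
  have hout : ∑ v ∈ faces m, q ^ |v.1 - c| * topSum Y v ^ 2 +
      ∑ v ∈ faces m, q ^ |v.1 - c| * botSum Y v ^ 2 ≤
      k * ∑ v ∈ faces m, q ^ |v.1 - c| * inEnergy Y v := by
    rw [← Finset.sum_add_distrib, Finset.mul_sum]
    refine Finset.sum_le_sum fun v _ => ?_
    have h1 := mul_le_mul_of_nonneg_left (outEnergy_le Y v) (zpow_pos hq0 |v.1 - c|).le
    have h2 : topSum Y v ^ 2 + botSum Y v ^ 2 ≤ outEnergy Y v := by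
      have := sq_nonneg (leftDiff Y v)
      have := sq_nonneg (rightSum Y v)
      rw [outEnergy]
      linarith
    have h3 := mul_le_mul_of_nonneg_left h2 (zpow_pos hq0 |v.1 - c|).le
    calc _ = q ^ |v.1 - c| * (topSum Y v ^ 2 + botSum Y v ^ 2) := by ring
      _ ≤ q ^ |v.1 - c| * (k * inEnergy Y v) := h3.trans h1
      _ = _ := by ring
  simp only [mul_add, Finset.sum_add_distrib] at hE
  calc botSum (obsSub m w w' c) (c, 0) ^ 2
      ≤ k * (C * (4 * ρ ^ 2 / Z ^ 2 * (k * (C * (8 * Z ^ 2))))) := by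
        refine hB.trans (mul_le_mul_of_nonneg_left ?_ hk)
        rw [← mul_add] at hE
        refine hE.trans (mul_le_mul_of_nonneg_left ?_ hC)
        refine (add_le_add hS hT).trans ?_
        rw [← mul_add]
        refine mul_le_mul_of_nonneg_left ?_ (by positivity)
        exact hout.trans (mul_le_mul_of_nonneg_left hO hk)
    _ = 32 * (k * C) ^ 2 * ρ ^ 2 := by
        have hZ0 : Z ≠ 0 := hZ'
        field_simp
        ring

/-- A function whose logarithmic derivative is bounded cannot vanish unless it is zero. -/
lemma eq_zero_of_abs_deriv_le {f f' : ℝ → ℝ} {K : ℝ} (hf : ∀ s, HasDerivAt f (f' s) s)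
    (hK : ∀ s, |s| ≤ 1 → |f' s| ≤ K * |f s|) {s₀ : ℝ} (hs₀ : |s₀| ≤ 1) (h₀ : f s₀ = 0) {s : ℝ}
    (hs : |s| ≤ 1) : f s = 0 := by
  rw [abs_le] at hs₀ hs
  rcases le_total s₀ s with h | h
  · exact eq_zero_of_abs_deriv_le_mul_abs_self_of_eq_zero_right (a := s₀) (b := 1)
      (fun u _ => (hf u).continuousAt.continuousWithinAt)
      (fun u _ => (hf u).hasDerivWithinAt) h₀
      (fun u hu => hK u (abs_le.2 ⟨hs₀.1.trans hu.1, hu.2.le⟩)) s ⟨h, hs.2⟩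
  · have hg : ∀ u, HasDerivAt (fun u => f (-u)) (-f' (-u)) u := fun u => by
      have := (hf (-u)).comp u (hasDerivAt_neg u)
      rwa [mul_neg, mul_one] at this
    have := eq_zero_of_abs_deriv_le_mul_abs_self_of_eq_zero_right (f := fun u => f (-u))
      (a := -s₀) (b := 1) (K := K)
      (fun u _ => (hg u).continuousAt.continuousWithinAt)
      (fun u _ => (hg u).hasDerivWithinAt) (by simpa using h₀)
      (fun u hu => by
        have := hK (-u) (abs_le.2 ⟨by linarith [hu.2], by linarith [hu.1]⟩)
        simpa using this) (-s) ⟨by linarith, by linarith⟩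
    simpa using this

lemma sum_zpow_le {q : ℝ} (hq : 1 < q) (m : ℕ) :
    ∑ c ∈ Finset.Ico (-1 : ℤ) m, q ^ (-(c + 1)) ≤ q / (q - 1) := by
  have hq0 : 0 < q := by linarith
  have h1 : ∑ c ∈ Finset.Ico (-1 : ℤ) m, q ^ (-(c + 1)) = ∑ k ∈ Finset.range (m + 1), q⁻¹ ^ k := by
    symm
    refine Finset.sum_nbij' (fun k => (k : ℤ) - 1) (fun c => (c + 1).toNat) ?_ ?_ ?_ ?_ ?_
    · intro k hk
      rw [Finset.mem_range] at hk
      rw [Finset.mem_Ico]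
      omega
    · intro c hc
      rw [Finset.mem_Ico] at hc
      rw [Finset.mem_range]
      omega
    · intro k _
      simp
    · intro c hc
      rw [Finset.mem_Ico] at hc
      omega
    · intro k _
      simp
  have h2 : q⁻¹ < 1 := inv_lt_one_of_one_lt₀ hq
  have h3 := (summable_geometric_of_lt_one (inv_nonneg.2 hq0.le) h2).sum_le_tsum
    (Finset.range (m + 1)) fun _ _ => by positivity
  rw [tsum_geometric_of_lt_one (inv_nonneg.2 hq0.le) h2] at h3
  rw [h1]
  refine h3.trans_eq ?_
  have : q - 1 ≠ 0 := by linarith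
  field_simp

section SlitEstimates

variable {x q : ℝ} {n m : ℕ}

lemma weightBound_slitWeight (hx0 : 0 ≤ x) (n m : ℕ) {s t : ℝ} (hs : |s| ≤ 1) (ht : |t| ≤ 1) :
    WeightBound m x (slitWeight x n m s t) :=
  ⟨abs_slitWeight_le hx0 n m hs ht, fun e he => by simp [slitWeight, he]⟩

lemma mem_faces_of_mem_Ico (hm : 1 ≤ m) {c : ℤ} (hc : c ∈ Finset.Ico (-1 : ℤ) m) :
    (c, (0 : ℤ)) ∈ faces m := by
  rw [Finset.mem_Ico] at hc
  rw [mem_faces]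
  omega

/-- The partition function vanishes either nowhere or everywhere as the factor on the right of
the segment varies. -/
lemma partFun_slitWeight_ne_zero (hx0 : 0 ≤ x) (hx : x ≤ 1) (hq : 1 < q)
    (hqx : q ^ 2 * x ^ 2 * (1 + √2) ^ 2 < 1) (hm : 1 ≤ m) {t : ℝ} (ht : |t| ≤ 1) {s₀ : ℝ}
    (hs₀ : |s₀| ≤ 1) (h₀ : partFun m (slitWeight x n m s₀ t) ≠ 0) {s : ℝ} (hs : |s| ≤ 1) :
    partFun m (slitWeight x n m s t) ≠ 0 := by
  intro h
  refine h₀ (eq_zero_of_abs_deriv_le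
    (fun s => hasDerivAt_partFun_slitWeight x (n := n) hm s t)
    (K := ∑ c ∈ Finset.Ico (-1 : ℤ) m, x / 2 * √((1 + √2) ^ 2 * (energyConst x q * 8)))
    (fun u hu => ?_) hs h hs₀)
  rw [Finset.sum_mul]
  refine (Finset.abs_sum_le_sum_abs _ _).trans (Finset.sum_le_sum fun c hc => ?_)
  have := obs_botSum_sq_le (mem_faces_of_mem_Ico hm hc) (weightBound_slitWeight hx0 n m hu ht) hx
    hq hqx
  have h2 := Real.abs_le_sqrt this
  rw [← mul_assoc, ← mul_assoc, Real.sqrt_mul' _ (sq_nonneg _), Real.sqrt_sq_eq_abs,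
    mul_assoc ((1 + √2) ^ 2)] at h2
  rw [abs_mul, abs_neg, abs_of_nonneg (by linarith : 0 ≤ x / 2), mul_assoc]
  exact mul_le_mul_of_nonneg_left h2 (by linarith)

/-- Derivative of the logarithm of the ratio of partition functions. -/
lemma abs_logDeriv_sub_le (hx0 : 0 ≤ x) (hx : x ≤ 1) (hq : 1 < q)
    (hqx : q ^ 2 * x ^ 2 * (1 + √2) ^ 2 < 1) (hn : 1 ≤ n) (hm : 1 ≤ m) {s : ℝ} (hs : |s| ≤ 1)
    (h1 : partFun m (slitWeight x n m s 1) ≠ 0) (h2 : partFun m (slitWeight x n m s (-1)) ≠ 0) :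
    |(∑ c ∈ Finset.Ico (-1 : ℤ) m, -(x / 2) *
        (obs m (slitWeight x n m s 1) c (c, 0) (c, 0) +
          obs m (slitWeight x n m s 1) c (c, 0) (c + 1, 0))) / partFun m (slitWeight x n m s 1) -
      (∑ c ∈ Finset.Ico (-1 : ℤ) m, -(x / 2) *
        (obs m (slitWeight x n m s (-1)) c (c, 0) (c, 0) +
          obs m (slitWeight x n m s (-1)) c (c, 0) (c + 1, 0))) /
        partFun m (slitWeight x n m s (-1))| ≤
      3 * ((1 + √2) ^ 2 * energyConst x q) * (q / (q - 1)) * (q⁻¹) ^ n := by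
  have hq0 : 0 < q := by linarith
  have hB : 0 ≤ (1 + √2) ^ 2 * energyConst x q :=
    mul_nonneg (sq_nonneg _) (energyConst_nonneg hq hqx)
  rw [Finset.sum_div, Finset.sum_div, ← Finset.sum_sub_distrib]
  calc _ ≤ ∑ c ∈ Finset.Ico (-1 : ℤ) m,
        3 * ((1 + √2) ^ 2 * energyConst x q) * (q⁻¹) ^ n * q ^ (-(c + 1)) := by
        refine (Finset.abs_sum_le_sum_abs _ _).trans (Finset.sum_le_sum fun c hc => ?_)
        have hc1 := (Finset.mem_Ico.1 hc).1
        have h := obsSub_botSum_sq_le (n := n) (mem_faces_of_mem_Ico hm hc) (by omega)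
          (weightBound_slitWeight hx0 n m hs (by simp))
          (weightBound_slitWeight hx0 n m hs (by simp)) hx hq hqx (fun e he => ?_) h1 h2
        · have h' : botSum (obsSub m (slitWeight x n m s 1) (slitWeight x n m s (-1)) c) (c, 0) ^ 2
              ≤ (6 * ((1 + √2) ^ 2 * energyConst x q) * q ^ (-(n + 1 + c) : ℤ)) ^ 2 := by
            refine h.trans ?_
            rw [mul_pow, mul_pow]
            have := mul_nonneg (sq_nonneg ((1 + √2) ^ 2 * energyConst x q))
              (sq_nonneg (q ^ (-(n + 1 + c) : ℤ)))
            linarith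
          have h4 := abs_le_of_sq_le_sq h' (by positivity)
          have h5 : q ^ (-(n + 1 + c) : ℤ) = (q⁻¹) ^ n * q ^ (-(c + 1)) := by
            rw [inv_pow, ← zpow_natCast, ← zpow_neg, ← zpow_add₀ hq0.ne']
            congr 1
            ring
          rw [h5] at h4
          set b := botSum (obsSub m (slitWeight x n m s 1) (slitWeight x n m s (-1)) c) (c, 0)
            with hb
          have h6 : ∀ y : ℝ, y = -(x / 2) * b → |y| ≤ 3 * ((1 + √2) ^ 2 * energyConst x q) *
              (q⁻¹) ^ n * q ^ (-(c + 1)) := by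
            rintro y rfl
            rw [abs_mul, abs_neg, abs_of_nonneg (by linarith : 0 ≤ x / 2)]
            calc x / 2 * |b| ≤ 1 / 2 * |b| := by gcongr
              _ ≤ _ := by linarith
          apply h6
          rw [hb, botSum, obsSub, obsSub]
          ring
        · unfold slitWeight
          split_ifs with h
          · congr 1
            unfold axisFactor
            split_ifs with h1 h2 h3 <;> first | rfl | exact absurd ⟨h1.1, h1.2, not_le.1 h3⟩ he
          · rfl
    _ ≤ _ := by
        rw [← Finset.mul_sum]
        have := mul_le_mul_of_nonneg_left (sum_zpow_le hq m)
          (by positivity : 0 ≤ 3 * ((1 + √2) ^ 2 * energyConst x q) * (q⁻¹) ^ n)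
        linarith

lemma le_exp_mul_sub_of_log_sub_le {a b ε K : ℝ} (hb : 0 ≤ b) (hab : 0 < a - b) (hε : 0 ≤ ε)
    (hεK : ε ≤ K) (h : Real.log (a + b) - Real.log (a - b) ≤ ε) :
    b ≤ ε * Real.exp K * a := by
  have hexp : a + b ≤ Real.exp ε * (a - b) := by
    rw [← Real.log_div (by linarith) hab.ne',
      Real.log_le_iff_le_exp (div_pos (by linarith) hab), div_le_iff₀ hab] at h
    exact h
  have h1 : Real.exp ε - 1 ≤ ε * Real.exp ε := by
    have h2 := Real.add_one_le_exp (-ε)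
    have h3 := mul_le_mul_of_nonneg_right h2 (Real.exp_pos ε).le
    rw [← Real.exp_add, neg_add_cancel, Real.exp_zero] at h3
    linarith
  have ha : 0 ≤ a := by linarith
  have h4 : b ≤ (Real.exp ε - 1) * a := by
    have := mul_nonneg (Real.exp_pos ε).le hb
    linarith
  calc b ≤ (Real.exp ε - 1) * a := h4
    _ ≤ (ε * Real.exp K) * a := by
      gcongr
      exact h1.trans (by gcongr)

/-- The segment is unlikely to be surrounded by a contour. -/
lemma contourSum_segment_le (hx0 : 0 < x) (hx : x ≤ 1) (hq : 1 < q)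
    (hqx : q ^ 2 * x ^ 2 * (1 + √2) ^ 2 < 1) {N : ℕ} (hn : 1 ≤ n) (hnN : n ≤ N) {K : ℝ}
    (hK : K = 3 * ((1 + √2) ^ 2 * energyConst x q) * (q / (q - 1))) :
    contourSum x (segment n) (box N) ≤
      K * Real.exp K * (q⁻¹) ^ n * contourSum x ∅ (box N \ segment n) := by
  have hq0 : 0 < q := by linarith
  have hK0 : 0 ≤ K := by
    have h1 := energyConst_nonneg hq hqx
    have h2 : 0 ≤ q / (q - 1) := div_nonneg hq0.le (by linarith)
    rw [hK]
    positivity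
  have hZ := fun {s t : ℝ} => partFun_slitWeight (s := s) (t := t) x hn hnN
  have hm : 1 ≤ N + 1 := by omega
  have hpos := contourSum_empty_pos hx0 (box N \ segment n)
  have hnn := contourSum_nonneg hx0.le (segment n) (box N)
  set Ze := contourSum x ∅ (box N \ segment n)
  set Zo := contourSum x (segment n) (box N)
  set Z : ℝ → ℝ → ℝ := fun s t => partFun (N + 1) (slitWeight x n (N + 1) s t) with hZdef
  have z11 : Z 1 1 = Ze + Zo := by rw [hZdef]; dsimp only; rw [hZ] <;> norm_num
  have z12 : Z 1 (-1) = Ze - Zo := by rw [hZdef]; dsimp only; rw [hZ] <;> norm_num; ring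
  have z21 : Z (-1) 1 = Ze - Zo := by rw [hZdef]; dsimp only; rw [hZ] <;> norm_num; ring
  have z22 : Z (-1) (-1) = Ze + Zo := by rw [hZdef]; dsimp only; rw [hZ] <;> norm_num
  have hsum : 0 < Ze + Zo := by linarith
  have hne1 : ∀ s, |s| ≤ 1 → Z s 1 ≠ 0 := fun s hs =>
    partFun_slitWeight_ne_zero hx0.le hx hq hqx hm (by simp) (s₀ := 1) (by simp)
      (by change Z 1 1 ≠ 0; rw [z11]; exact hsum.ne') hs
  have hne2 : ∀ s, |s| ≤ 1 → Z s (-1) ≠ 0 := fun s hs =>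
    partFun_slitWeight_ne_zero hx0.le hx hq hqx hm (by simp) (s₀ := -1) (by simp)
      (by change Z (-1) (-1) ≠ 0; rw [z22]; exact hsum.ne') hs
  have hdiff : 0 < Ze - Zo := by
    by_contra! hle
    have hcont : ContinuousOn (fun s => Z s 1) (Set.Icc (-1) 1) := fun s _ =>
      (hasDerivAt_partFun_slitWeight x hm s 1).continuousAt.continuousWithinAt
    obtain ⟨s, hs, h0⟩ := intermediate_value_Icc (by norm_num) hcont
      (show (0 : ℝ) ∈ Set.Icc (Z (-1) 1) (Z 1 1) by rw [z11, z21]; exact ⟨hle, hsum.le⟩)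
    exact hne1 s (abs_le.2 hs) h0
  clear_value Ze Zo
  set ε := K * (q⁻¹) ^ n with hε
  have hmvt := Convex.norm_image_sub_le_of_norm_hasDerivWithin_le
    (s := Set.Icc (-1 : ℝ) 1) (f := fun s => Real.log (Z s 1) - Real.log (Z s (-1))) (C := ε)
    (fun s hs => (((hasDerivAt_partFun_slitWeight x hm s 1).log (hne1 s (abs_le.2 hs))).sub
      ((hasDerivAt_partFun_slitWeight x hm s (-1)).log (hne2 s (abs_le.2 hs)))).hasDerivWithinAt)
    (fun s hs => by
      rw [hε, hK]
      exact abs_logDeriv_sub_le hx0.le hx hq hqx hn hm (abs_le.2 hs) (hne1 s (abs_le.2 hs))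
        (hne2 s (abs_le.2 hs)))
    (convex_Icc _ _) (x := -1) (y := 1) (by simp) (by simp)
  simp only [z11, z12, z21, z22] at hmvt
  have hlog : Real.log (Ze + Zo) - Real.log (Ze - Zo) ≤ ε := by
    have := (Real.le_norm_self _).trans hmvt
    norm_num at this
    linarith
  have hε0 : 0 ≤ ε := by positivity
  have hεK : ε ≤ K := mul_le_of_le_one_right hK0
    (pow_le_one₀ (inv_nonneg.2 hq0.le) (inv_le_one_of_one_le₀ hq.le))
  rw [mul_assoc K, mul_comm (Real.exp K), ← mul_assoc K]
  exact le_exp_mul_sub_of_log_sub_le hnn hdiff hε0 hεK hlog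

end SlitEstimates

/-- Below the critical temperature a segment of minus spins is exponentially costly. -/
lemma exists_contourSum_segment_le {x : ℝ} (hx0 : 0 < x) (hx : x * (1 + √2) < 1) :
    ∃ C ρ : ℝ, 0 < C ∧ 0 < ρ ∧ ρ < 1 ∧ ∀ n N : ℕ, n < N →
      contourSum x (segment n) (box N) ≤ C * ρ ^ n * contourSum x ∅ (box N \ segment n) := by
  have h2 : 0 ≤ √2 := Real.sqrt_nonneg 2
  have hx1 : x ≤ 1 := by nlinarith
  set y := x * (1 + √2) with hy
  have hy0 : 0 < y := by positivity
  set q := 2 / (1 + y) with hq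
  have hq1 : 1 < q := by rw [hq, lt_div_iff₀ (by positivity)]; linarith
  have hqy : q * y < 1 := by
    rw [hq, div_mul_eq_mul_div, div_lt_one (by positivity)]
    linarith
  have hqx : q ^ 2 * x ^ 2 * (1 + √2) ^ 2 < 1 := by
    have : q ^ 2 * x ^ 2 * (1 + √2) ^ 2 = (q * y) ^ 2 := by rw [hy]; ring
    rw [this]
    exact pow_lt_one₀ (by positivity) hqy (by norm_num)
  obtain ⟨K, hK⟩ : ∃ K, K = 3 * ((1 + √2) ^ 2 * energyConst x q) * (q / (q - 1)) := ⟨_, rfl⟩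
  refine ⟨max 1 (K * Real.exp K), q⁻¹, by positivity, by positivity,
    inv_lt_one_of_one_lt₀ hq1, fun n N hnN => ?_⟩
  have hpos := contourSum_empty_pos hx0 (box N \ segment n)
  rcases Nat.eq_zero_or_pos n with rfl | hn
  · have : segment 0 = ∅ := by simp [segment]
    rw [this, Finset.sdiff_empty, pow_zero, mul_one]
    rw [this, Finset.sdiff_empty] at hpos
    exact le_mul_of_one_le_left hpos.le (le_max_left _ _)
  · refine (contourSum_segment_le hx0 hx1 hq1 hqx hn hnN.le hK).trans ?_
    exact mul_le_mul_of_nonneg_right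
      (mul_le_mul_of_nonneg_right (le_max_right _ _) (by positivity)) hpos.le

lemma exp_mul_lt_one_of_betaCrit_lt {β : ℝ} (hβ : betaCrit < β) :
    Real.exp (-2 * β) * (1 + √2) < 1 := by
  have h : 0 < 1 + √2 := by positivity
  rw [betaCrit] at hβ
  have h1 : 1 + √2 < Real.exp (2 * β) := by
    rw [← Real.log_lt_iff_lt_exp h]
    linarith
  calc Real.exp (-2 * β) * (1 + √2) < Real.exp (-2 * β) * Real.exp (2 * β) := by gcongr
    _ = 1 := by rw [← Real.exp_add]; simp

lemma betaCrit_nonneg : 0 ≤ betaCrit := by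
  have := Real.log_nonneg (x := 1 + √2) (by linarith [Real.sqrt_nonneg 2])
  rw [betaCrit]
  linarith

end PeierlsIsing

/-- For `β > β_c` and `h = 0` the limits
`θ_+ = −lim n⁻¹ log ν⁺(η ≡ −1 on [−n,−1])` and `θ_− = −lim n⁻¹ log ν⁺(η ≡ +1 on [−n,−1])`
exist and satisfy `θ_− < θ_+`. -/
theorem exponential_rates_exist_and_ordered
    (β : ℝ) (hβ : betaCrit < β) (μp : Measure Cfg2) (hμp : IsPlusPhase β 0 μp) :
    ∃ θp θm : ℝ,
      Tendsto (fun n : ℕ =>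
          -(Real.log ((schonmann μp) (allBlock n false)).toReal) / n) atTop (𝓝 θp) ∧
      Tendsto (fun n : ℕ =>
          -(Real.log ((schonmann μp) (allBlock n true)).toReal) / n) atTop (𝓝 θm) ∧
      θm < θp := by
  obtain ⟨C, ρ, hC, hρ, hρ1, hb⟩ := PeierlsIsing.exists_contourSum_segment_le
    (Real.exp_pos (-2 * β)) (PeierlsIsing.exp_mul_lt_one_of_betaCrit_lt hβ)
  exact PeierlsIsing.rate_lt_of_contourSum_le hμp (PeierlsIsing.betaCrit_nonneg.trans hβ.le)
    hC hρ hρ1 hb
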